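/- arXiv:1510.07135 — 2 statements merged into one kernel-verified Lean document; each statement's English description precedes it below -/
import Mathlib

section
/- Every 2-connected finite simple graph that does not contain K̂₄ as an induced minor and that contains a proper K₄-subdivision has a 3-wheel as a subgraph. -/
open SimpleGraph

namespace IMWQO

/-- `H` is an induced minor of `G`: there is a family of pairwise disjoint nonempty
connected subsets of `V(G)`, indexed by `V(H)`, such that distinct branch sets are
joined by an edge of `G` iff the corresponding vertices are adjacent in `H`. -/
def IsInducedMinor {α β : Type*} (H : SimpleGraph α) (G : SimpleGraph β) : Prop :=
  ∃ μ : α → Set β,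
    (∀ a, (μ a).Nonempty) ∧
    (∀ a b, a ≠ b → Disjoint (μ a) (μ b)) ∧
    (∀ a, (G.induce (μ a)).Connected) ∧
    (∀ a b, a ≠ b → ((∃ x ∈ μ a, ∃ y ∈ μ b, G.Adj x y) ↔ H.Adj a b))

/-- A bundled finite simple graph. -/
abbrev FinGraph := Σ n : ℕ, SimpleGraph (Fin n)

/-- The induced minor relation on bundled finite graphs. -/
def FinGraph.IM (H G : FinGraph) : Prop := IsInducedMinor H.2 G.2

/-- A class of finite graphs is well-quasi-ordered by the induced minor relation. -/
def WqoClass (P : FinGraph → Prop) : Prop :=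
  ∀ f : ℕ → FinGraph, (∀ i, P (f i)) → ∃ i j, i < j ∧ FinGraph.IM (f i) (f j)

/-- `K̂₄`: `K₄` (on vertices `0,1,2,3`) plus a vertex `4` adjacent to `0` and `1`. -/
def hatK4 : SimpleGraph (Fin 5) :=
  SimpleGraph.fromRel fun a b =>
    (a.val < 4 ∧ b.val < 4) ∨ (a.val = 4 ∧ (b.val = 0 ∨ b.val = 1))

/-- The gem: the path `0 - 1 - 2 - 3` plus a dominating vertex `4`. -/
def gem : SimpleGraph (Fin 5) :=
  SimpleGraph.fromRel fun a b =>
    (b.val = a.val + 1 ∧ b.val ≤ 3) ∨ a.val = 4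

/-- The complete graph on four vertices. -/
def K4 : SimpleGraph (Fin 4) := ⊤

/-- The prism, i.e. the Cartesian (box) product `K₃ □ K₂`. -/
def prism : SimpleGraph (Fin 3 × Fin 2) :=
  (⊤ : SimpleGraph (Fin 3)) □ (⊤ : SimpleGraph (Fin 2))

/-- The complete bipartite graph `K_{3,3}`. -/
def K33 : SimpleGraph (Fin 3 ⊕ Fin 3) := completeBipartiteGraph (Fin 3) (Fin 3)

/-- Subdivide the edge `{u,v}` of `G`, the new vertex being `Fin.last n`. -/
def subdivideEdge {n : ℕ} (G : SimpleGraph (Fin n)) (u v : Fin n) :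
    SimpleGraph (Fin (n + 1)) :=
  SimpleGraph.fromRel fun a b =>
    (∃ a' b' : Fin n, a = a'.castSucc ∧ b = b'.castSucc ∧ G.Adj a' b' ∧
      ¬(a' = u ∧ b' = v) ∧ ¬(a' = v ∧ b' = u))
    ∨ (a = Fin.last n ∧ (b = u.castSucc ∨ b = v.castSucc))

/-- One subdivision step on bundled graphs: the first graph is obtained from the
second one by subdividing one edge. -/
inductive SubdivStep : FinGraph → FinGraph → Prop
  | mk {n : ℕ} (G : SimpleGraph (Fin n)) (u v : Fin n) (h : G.Adj u v) :
      SubdivStep ⟨n + 1, subdivideEdge G u v⟩ ⟨n, G⟩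

/-- `G` is (isomorphic to) a subdivision of `H`. -/
def IsSubdivision {α β : Type*} (G : SimpleGraph α) (H : SimpleGraph β) : Prop :=
  ∃ A B : FinGraph, Nonempty (G ≃g A.2) ∧ Nonempty (H ≃g B.2) ∧
    Relation.ReflTransGen SubdivStep A B

/-- `G` contains a subdivision of `H` as a subgraph. -/
def ContainsSubdivAsSubgraph {α β : Type*} (G : SimpleGraph α) (H : SimpleGraph β) : Prop :=
  ∃ S : G.Subgraph, IsSubdivision S.coe H

/-- `G` has a proper `K₄`-subdivision: for some vertex `v`, `G - v` contains
a subdivision of `K₄` as a subgraph. -/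
def HasProperK4Subdivision {α : Type*} (G : SimpleGraph α) : Prop :=
  ∃ v : α, ContainsSubdivAsSubgraph (G.induce {u | u ≠ v}) K4

/-- `G` is 2-connected: at least 3 vertices, and removing any vertex leaves it connected. -/
def TwoConnected {α : Type*} [Fintype α] (G : SimpleGraph α) : Prop :=
  3 ≤ Fintype.card α ∧ ∀ v : α, (G.induce {u | u ≠ v}).Connected

/-- `G` is complete multipartite: two vertices are adjacent iff they lie in different
classes of some partition (equivalence relation). -/
def IsCompleteMultipartite {α : Type*} (G : SimpleGraph α) : Prop :=
  ∃ s : Setoid α, ∀ u v, G.Adj u v ↔ ¬ s.r u v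

/-- `G` is a cograph: it has no induced path on four vertices. -/
def IsCograph {α : Type*} (G : SimpleGraph α) : Prop :=
  ∀ f : Fin 4 → α, Function.Injective f →
    ¬ (∀ a b : Fin 4, G.Adj (f a) (f b) ↔ (pathGraph 4).Adj a b)

/-- `G` is a linear forest: acyclic with maximum degree at most 2,
i.e. a disjoint union of paths. -/
def IsLinearForest {α : Type*} (G : SimpleGraph α) : Prop :=
  G.IsAcyclic ∧ ∀ v, (G.neighborSet v).ncard ≤ 2

/-- The set `C` induces an (induced) cycle in `G`. -/
def InducesCycle {α : Type*} (G : SimpleGraph α) (C : Set α) : Prop :=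
  ∃ n : ℕ, 3 ≤ n ∧ Nonempty ((G.induce C) ≃g cycleGraph n)

/-- The set `S` induces a path in `G` all of whose internal vertices have degree two
in `G`. -/
def IsBasicPath {α : Type*} (G : SimpleGraph α) (S : Set α) : Prop :=
  ∃ (n : ℕ) (φ : (G.induce S) ≃g pathGraph n),
    ∀ v : S, (φ v).val ≠ 0 → (φ v).val ≠ n - 1 → (G.neighborSet v.val).ncard = 2

/-- The wheel with cycle `0, …, n-1` and center adjacent to the vertices of `T`. -/
def wheelGraph (n : ℕ) (T : Finset (Fin n)) : SimpleGraph (Fin n ⊕ Unit) :=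
  SimpleGraph.fromRel fun a b =>
    (∃ x y : Fin n, a = Sum.inl x ∧ b = Sum.inl y ∧ (cycleGraph n).Adj x y)
    ∨ (∃ x ∈ T, a = Sum.inr () ∧ b = Sum.inl x)

/-- `G` is a `k`-wheel: a cycle of order at least `max k 3` plus a center adjacent to
exactly `k` distinct vertices of the cycle. -/
def IsWheel {α : Type*} (k : ℕ) (G : SimpleGraph α) : Prop :=
  ∃ n : ℕ, 3 ≤ n ∧ k ≤ n ∧ ∃ T : Finset (Fin n), T.card = k ∧
    Nonempty (G ≃g wheelGraph n T)

/-- A 3-wheel subgraph of `G`: a cycle of `G` together with a center outside the cycle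
joined to (at least) three distinct vertices of the cycle by edges of `G`. -/
structure ThreeWheelSub {α : Type*} (G : SimpleGraph α) where
  base : α
  cyc : G.Walk base base
  cyc_isCycle : cyc.IsCycle
  center : α
  center_not_mem : center ∉ cyc.support
  spokes : Finset α
  spokes_card : spokes.card = 3
  spokes_sub : ∀ x ∈ spokes, x ∈ cyc.support
  spokes_adj : ∀ x ∈ spokes, G.Adj center x

/-- The number of vertices of a 3-wheel subgraph. -/
def ThreeWheelSub.order {α : Type*} [DecidableEq α] {G : SimpleGraph α}
    (W : ThreeWheelSub G) : ℕ :=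
  W.cyc.support.toFinset.card + 1

/-- `G` has a cycle-multipartite decomposition. -/
def HasCycleMultipartiteDecomp {α : Type*} (G : SimpleGraph α) : Prop :=
  ∃ C R : Set α, C ∪ R = Set.univ ∧ Disjoint C R ∧
    InducesCycle G C ∧ IsCompleteMultipartite (G.induce R) ∧
    ∀ u ∈ R, ∀ v ∈ R, ∀ c ∈ C, (G.Adj u c ↔ G.Adj v c)

/-- A bundled finite simple graph whose vertices are labeled by finite subsets of `S`. -/
structure LabGraph (S : Type*) where
  n : ℕ
  graph : SimpleGraph (Fin n)
  label : Fin n → Finset S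

/-- The domination order on finite subsets of a quasi-order: `A ≤^P B` iff there is an
injection `φ : A → B` with `r a (φ a)` for all `a ∈ A`. -/
def FinsetLE {S : Type*} (r : S → S → Prop) (A B : Finset S) : Prop :=
  ∃ φ : {x // x ∈ A} → {x // x ∈ B}, Function.Injective φ ∧ ∀ a, r a.val (φ a).val

/-- The union of the labels of the vertices in `A`. -/
noncomputable def labelUnion {S : Type*} {n : ℕ} (lab : Fin n → Finset S)
    (A : Finset (Fin n)) : Finset S :=
  letI := Classical.decEq S
  A.biUnion lab

/-- Label-respecting induced minor relation on labeled graphs. -/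
def LabIM {S : Type*} (r : S → S → Prop) (H G : LabGraph S) : Prop :=
  ∃ μ : Fin H.n → Finset (Fin G.n),
    (∀ a, (μ a).Nonempty) ∧
    (∀ a b, a ≠ b → Disjoint (μ a) (μ b)) ∧
    (∀ a, (G.graph.induce (↑(μ a) : Set (Fin G.n))).Connected) ∧
    (∀ a b, a ≠ b → ((∃ x ∈ μ a, ∃ y ∈ μ b, G.graph.Adj x y) ↔ H.graph.Adj a b)) ∧
    (∀ a, FinsetLE r (H.label a) (labelUnion G.label (μ a)))

/-- Label-respecting contraction relation on labeled graphs: an induced minor model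
whose branch sets cover all vertices. -/
def LabContraction {S : Type*} (r : S → S → Prop) (H G : LabGraph S) : Prop :=
  ∃ μ : Fin H.n → Finset (Fin G.n),
    (∀ a, (μ a).Nonempty) ∧
    (∀ a b, a ≠ b → Disjoint (μ a) (μ b)) ∧
    (∀ x : Fin G.n, ∃ a, x ∈ μ a) ∧
    (∀ a, (G.graph.induce (↑(μ a) : Set (Fin G.n))).Connected) ∧
    (∀ a b, a ≠ b → ((∃ x ∈ μ a, ∃ y ∈ μ b, G.graph.Adj x y) ↔ H.graph.Adj a b)) ∧
    (∀ a, FinsetLE r (H.label a) (labelUnion G.label (μ a)))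

/-- Label-respecting induced subgraph relation on labeled graphs. -/
def LabISub {S : Type*} (r : S → S → Prop) (H G : LabGraph S) : Prop :=
  ∃ φ : Fin H.n → Fin G.n, Function.Injective φ ∧
    (∀ a b, H.graph.Adj a b ↔ G.graph.Adj (φ a) (φ b)) ∧
    (∀ a, FinsetLE r (H.label a) (G.label (φ a)))

/-- A relation is a well-quasi-order: every infinite sequence contains a good pair. -/
def IsWqo {S : Type*} (r : S → S → Prop) : Prop :=
  ∀ g : ℕ → S, ∃ i j, i < j ∧ r (g i) (g j)


section Connectivity

variable {V : Type*} {G : SimpleGraph V}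

/-- `S` is the vertex set of a path of `G` from `x` to `y`. -/
def PathSet (G : SimpleGraph V) (x y : V) (S : Set V) : Prop :=
  ∃ p : G.Walk x y, p.IsPath ∧ S = {v | v ∈ p.support}

namespace PathSet

variable {x y z : V} {S T : Set V}

lemma left_mem (h : PathSet G x y S) : x ∈ S := by
  obtain ⟨p, -, rfl⟩ := h
  exact p.start_mem_support

lemma right_mem (h : PathSet G x y S) : y ∈ S := by
  obtain ⟨p, -, rfl⟩ := h
  exact p.end_mem_support

lemma connected (h : PathSet G x y S) : (G.induce S).Connected := by
  obtain ⟨p, -, rfl⟩ := h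
  exact p.connected_induce_support

lemma singleton (x : V) : PathSet G x x {x} :=
  ⟨.nil, .nil, by ext; simp⟩

lemma symm (h : PathSet G x y S) : PathSet G y x S := by
  obtain ⟨p, hp, rfl⟩ := h
  exact ⟨p.reverse, hp.reverse, by ext; simp⟩

lemma trans (hS : PathSet G x y S) (hT : PathSet G y z T) (h : S ∩ T ⊆ {y}) :
    PathSet G x z (S ∪ T) := by
  obtain ⟨p, hp, rfl⟩ := hS
  obtain ⟨q, hq, rfl⟩ := hT
  refine ⟨p.append q, ?_, by ext; simp [Walk.mem_support_append_iff]⟩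
  rw [Walk.isPath_def, Walk.support_append, List.nodup_append']
  refine ⟨hp.support_nodup, hq.support_nodup.tail, fun v hv hv' => ?_⟩
  have hy : v = y := h ⟨hv, List.mem_of_mem_tail hv'⟩
  subst hy
  have := hq.support_nodup
  rw [← Walk.cons_tail_support] at this
  exact (List.nodup_cons.1 this).1 hv'

lemma pair (h : G.Adj x y) : PathSet G x y {x, y} :=
  ⟨.cons h .nil, by simp [h.ne], by ext; simp⟩

lemma split (h : PathSet G x y S) {v : V} (hv : v ∈ S) :
    ∃ P Q, PathSet G x v P ∧ PathSet G v y Q ∧ P ∪ Q = S ∧ P ∩ Q ⊆ {v} := by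
  obtain ⟨p, hp, rfl⟩ := h
  obtain ⟨q, r, hq, hr, rfl⟩ := hp.mem_support_iff_exists_append.1 hv
  refine ⟨_, _, ⟨q, hq, rfl⟩, ⟨r, hr, rfl⟩, ?_, ?_⟩
  · ext; simp [Walk.mem_support_append_iff]
  · rintro u ⟨hu, hu'⟩
    by_contra hne
    exact hp.ne_of_mem_support_of_append hne hu hu' rfl

/-- Removing the last vertex of a nontrivial path leaves a connected set attached to it. -/
lemma sdiff_right (h : PathSet G x y S) (hne : x ≠ y) :
    (G.induce (S \ {y})).Connected ∧ ∃ u ∈ S \ {y}, G.Adj u y := by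
  obtain ⟨p, hp, rfl⟩ := h.symm
  cases p with
  | nil => exact absurd rfl hne
  | cons hadj q =>
    rename_i u
    rw [Walk.cons_isPath_iff] at hp
    have : {v | v ∈ (Walk.cons hadj q).support} \ {y} = {v | v ∈ q.support} := by
      ext v
      simp only [Walk.support_cons, List.mem_cons, Set.mem_sdiff, Set.mem_ofPred_eq,
        Set.mem_singleton_iff]
      constructor
      · tauto
      · intro hv
        exact ⟨Or.inr hv, fun h => hp.2 (h ▸ hv)⟩
    rw [this]
    exact ⟨q.connected_induce_support, u, q.start_mem_support, hadj.symm⟩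

lemma adj_of_subset_pair (h : PathSet G x y S) (hne : x ≠ y) (hS : S ⊆ {x, y}) :
    G.Adj x y := by
  obtain ⟨-, u, ⟨hu, huy⟩, hadj⟩ := h.sdiff_right hne
  rcases hS hu with rfl | rfl
  · exact hadj
  · exact absurd rfl huy

lemma exists_isCycle {P Q : Set V} (hP : PathSet G x y P) (hQ : PathSet G y x Q)
    (h : P ∩ Q ⊆ {x, y}) {t : V} (ht : t ∈ P) (htx : t ≠ x) (hty : t ≠ y) :
    ∃ c : G.Walk x x, c.IsCycle ∧ ∀ v, v ∈ c.support ↔ v ∈ P ∪ Q := by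
  obtain ⟨p, hp, rfl⟩ := hP
  obtain ⟨q, hq, rfl⟩ := hQ
  refine ⟨p.append q, hp.isCycle_append hq ?_ (Or.inl ?_), fun v => by
    simp [Walk.mem_support_append_iff]⟩
  · intro v hv hv'
    have hpn := hp.support_nodup
    have hqn := hq.support_nodup
    rw [← Walk.cons_tail_support] at hpn hqn
    rcases h ⟨List.mem_of_mem_tail hv, List.mem_of_mem_tail hv'⟩ with rfl | rfl
    · exact (List.nodup_cons.1 hpn).1 hv
    · exact (List.nodup_cons.1 hqn).1 hv'
  · match p, ht with
    | .nil, ht => simp at ht; exact absurd ht htx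
    | .cons _ .nil, ht => simp at ht; tauto
    | .cons _ (.cons _ _), _ => simp

end PathSet

/-- Two vertices of a connected set are joined by a path inside it. -/
lemma exists_pathSet_subset {S : Set V} (hS : (G.induce S).Connected) {x y : V} (hx : x ∈ S)
    (hy : y ∈ S) : ∃ P ⊆ S, PathSet G x y P := by
  classical
  obtain ⟨w⟩ := hS.preconnected ⟨x, hx⟩ ⟨y, hy⟩
  let p : G.Walk x y := w.map (Embedding.induce S).toHom
  refine ⟨_, ?_, p.bypass, p.bypass_isPath, rfl⟩
  intro v hv
  have := p.support_bypass_subset_support hv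
  obtain ⟨u, -, rfl⟩ := List.mem_map.1 (Walk.support_map _ w ▸ this)
  exact u.2

/-- A set is connected if some vertex is joined to all its vertices by paths inside it. -/
lemma connected_of_pathSet {S : Set V} {x : V} (hx : x ∈ S)
    (h : ∀ y ∈ S, ∃ P ⊆ S, x ∈ P ∧ y ∈ P ∧ (G.induce P).Connected) :
    (G.induce S).Connected :=
  induce_connected_of_patches x hx fun {y} hy =>
    let ⟨P, hP, hxP, hyP, hc⟩ := h y hy
    ⟨P, hP, hxP, hyP, hc.preconnected _ _⟩

lemma connected_singleton (x : V) : (G.induce {x}).Connected :=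
  (PathSet.singleton x).connected

/-- A path from `z` to a vertex of `P` can be cut at its first vertex in `P`. -/
lemma exists_pathSet_first_hit {P : Set V} {z x : V} (p : G.Walk z x) (hp : p.IsPath)
    (hx : x ∈ P) :
    ∃ m ∈ P, ∃ R ⊆ {v | v ∈ p.support}, PathSet G z m R ∧ R ∩ P ⊆ {m} := by
  induction p with
  | nil => exact ⟨_, hx, {_}, by simp, .singleton _, Set.inter_subset_left⟩
  | @cons z v x hadj q ih =>
    rw [Walk.cons_isPath_iff] at hp
    by_cases hz : z ∈ P
    · exact ⟨z, hz, {z}, by simp, .singleton _, Set.inter_subset_left⟩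
    obtain ⟨m, hm, R, hR, hpath, hRP⟩ := ih hp.1 hx
    refine ⟨m, hm, {z, v} ∪ R, ?_, (PathSet.pair hadj).trans hpath ?_, ?_⟩
    · rintro u ((rfl | rfl) | hu)
      · simp
      · simp
      · exact List.mem_cons_of_mem _ (hR hu)
    · rintro u ⟨rfl | rfl, hu⟩
      · exact absurd (hR hu) hp.2
      · rfl
    · rintro u ⟨(rfl | rfl) | hu, huP⟩
      · exact absurd huP hz
      · exact hRP ⟨hpath.left_mem, huP⟩
      · exact hRP ⟨hu, huP⟩

/-- Three vertices of a connected set are the ends of three paths inside it that start at a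
common vertex and are otherwise disjoint. -/
lemma exists_tripod {S : Set V} (hS : (G.induce S).Connected) (c : Fin 3 → V)
    (hc : ∀ i, c i ∈ S) :
    ∃ m ∈ S, ∃ L : Fin 3 → Set V, (∀ i, L i ⊆ S) ∧ (∀ i, PathSet G m (c i) (L i)) ∧
      ∀ i j, i ≠ j → L i ∩ L j ⊆ {m} := by
  obtain ⟨P, hPS, hP⟩ := exists_pathSet_subset hS (hc 0) (hc 1)
  obtain ⟨Q, hQS, q, hq, rfl⟩ := exists_pathSet_subset hS (hc 2) (hc 0)
  obtain ⟨m, hm, R, hR, hpath, hRP⟩ := exists_pathSet_first_hit q hq hP.left_mem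
  obtain ⟨P₀, P₁, h₀, h₁, hU, hI⟩ := hP.split hm
  have hP₀ : P₀ ⊆ P := hU ▸ Set.subset_union_left
  have hP₁ : P₁ ⊆ P := hU ▸ Set.subset_union_right
  refine ⟨m, hPS hm, ![P₀, P₁, R], ?_, ?_, ?_⟩
  · intro i
    fin_cases i
    exacts [hP₀.trans hPS, hP₁.trans hPS, hR.trans hQS]
  · intro i
    fin_cases i
    exacts [h₀.symm, h₁, hpath.symm]
  · have h02 : P₀ ∩ R ⊆ {m} := fun v hv => hRP ⟨hv.2, hP₀ hv.1⟩
    have h12 : P₁ ∩ R ⊆ {m} := fun v hv => hRP ⟨hv.2, hP₁ hv.1⟩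
    intro i j hij
    fin_cases i <;> fin_cases j <;>
      first
      | exact absurd rfl hij
      | assumption
      | (rw [Set.inter_comm]; assumption)

/-- A connected set splits into two connected parts separating two given vertices. -/
lemma exists_connected_split [Finite V] {S : Set V} (hS : (G.induce S).Connected) {p q : V}
    (hp : p ∈ S) (hq : q ∈ S) (hpq : p ≠ q) :
    ∃ A B, (G.induce A).Connected ∧ (G.induce B).Connected ∧ p ∈ A ∧ q ∈ B ∧ A ∪ B = S ∧
      Disjoint A B ∧ ∃ x ∈ A, ∃ y ∈ B, G.Adj x y := by
  obtain ⟨B, hB⟩ := (Set.toFinite {B : Set V | B ⊆ S ∧ p ∉ B ∧ q ∈ B ∧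
    (G.induce B).Connected}).exists_maximal
    ⟨{q}, by simpa using hq, by simpa using hpq, rfl, connected_singleton q⟩
  obtain ⟨hBS, hpB, hqB, hBc⟩ := hB.prop
  have key : ∀ u ∈ S, u ∉ B → u ≠ p → ∀ v ∈ B, ¬ G.Adj u v := by
    intro u hu huB hup v hv hadj
    refine huB (hB.le_of_ge (y := {u} ∪ B) ⟨?_, ?_, ?_, ?_⟩ Set.subset_union_right (Or.inl rfl))
    · exact Set.union_subset (by simpa using hu) hBS
    · rintro (h | h)
      exacts [hup h.symm, hpB h]
    · exact Or.inr hqB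
    · exact connected_induce_union (connected_singleton u).preconnected hBc.preconnected rfl hv hadj
  have reach : ∀ u (w : G.Walk u p), (∀ v ∈ w.support, v ∈ S) → u ∉ B →
      ∃ P ⊆ S \ B, p ∈ P ∧ u ∈ P ∧ (G.induce P).Connected := by
    intro u w
    induction w with
    | nil => exact fun _ _ => ⟨{_}, by simpa using ⟨hp, hpB⟩, rfl, rfl, connected_singleton _⟩
    | @cons u v p hadj w ih =>
      intro hw hu
      by_cases hup : u = p
      · subst hup
        exact ⟨{_}, by simpa using ⟨hp, hpB⟩, rfl, rfl, connected_singleton _⟩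
      have huS : u ∈ S := hw _ (Walk.start_mem_support _)
      obtain ⟨P, hP, hpP, hvP, hc⟩ := ih hp hpq hB hpB key
        (fun x hx => hw x (List.mem_cons_of_mem _ hx)) (fun hv => key u huS hu hup v hv hadj)
      refine ⟨{u} ∪ P, Set.union_subset (by simpa using ⟨huS, hu⟩) hP, Or.inr hpP, Or.inl rfl, ?_⟩
      exact connected_induce_union (connected_singleton u).preconnected hc.preconnected rfl hvP hadj
  refine ⟨S \ B, B, ?_, hBc, ⟨hp, hpB⟩, hqB, Set.sdiff_union_of_subset hBS,
    Set.disjoint_sdiff_left, ?_⟩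
  · refine connected_of_pathSet (x := p) ⟨hp, hpB⟩ fun u hu => ?_
    obtain ⟨P, hPS, w, -, rfl⟩ := exists_pathSet_subset hS hu.1 hp
    exact reach u w hPS hu.2
  · obtain ⟨P, hPS, w, -, rfl⟩ := exists_pathSet_subset hS hp hq
    obtain ⟨d, hd, h1, h2⟩ := w.exists_boundary_dart Bᶜ hpB (by simpa using hqB)
    exact ⟨d.fst, ⟨hPS (w.dart_fst_mem_support_of_mem_darts hd), h1⟩, d.snd, by simpa using h2,
      d.adj⟩

end Connectivity

section Model

variable {V W : Type*} {G : SimpleGraph V} {H : SimpleGraph W}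

/-- Some edge of `G` joins a vertex of `S` to a vertex of `T`. -/
def Touches (G : SimpleGraph V) (S T : Set V) : Prop := ∃ x ∈ S, ∃ y ∈ T, G.Adj x y

lemma Touches.symm {S T : Set V} (h : Touches G S T) : Touches G T S :=
  let ⟨x, hx, y, hy, hxy⟩ := h
  ⟨y, hy, x, hx, hxy.symm⟩

lemma Touches.mono {S T S' T' : Set V} (h : Touches G S T) (hS : S ⊆ S') (hT : T ⊆ T') :
    Touches G S' T' :=
  let ⟨x, hx, y, hy, hxy⟩ := h
  ⟨x, hS hx, y, hT hy, hxy⟩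

lemma Touches.of_union_left {S S' T : Set V} (h : Touches G (S ∪ S') T) :
    Touches G S T ∨ Touches G S' T := by
  obtain ⟨x, hx | hx, y, hy, hxy⟩ := h
  exacts [Or.inl ⟨x, hx, y, hy, hxy⟩, Or.inr ⟨x, hx, y, hy, hxy⟩]

/-- The sets `A i` are the branch sets of a `K₄`-minor of `G`. -/
structure IsK4Model (G : SimpleGraph V) (A : Fin 4 → Set V) : Prop where
  connected : ∀ i, (G.induce (A i)).Connected
  disjoint : ∀ i j, i ≠ j → Disjoint (A i) (A j)
  touches : ∀ i j, i ≠ j → Touches G (A i) (A j)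

/-- It suffices to verify the conditions on a model for `i < j`. -/
lemma IsK4Model.of_lt {A : Fin 4 → Set V} (hc : ∀ i, (G.induce (A i)).Connected)
    (hd : ∀ i j, i < j → Disjoint (A i) (A j)) (ht : ∀ i j, i < j → Touches G (A i) (A j)) :
    IsK4Model G A where
  connected := hc
  disjoint i j hij := by
    rcases hij.lt_or_gt with h | h
    exacts [hd i j h, (hd j i h).symm]
  touches i j hij := by
    rcases hij.lt_or_gt with h | h
    exacts [ht i j h, (ht j i h).symm]

lemma connected_image (φ : G →g H) {S : Set V} (hS : (G.induce S).Connected) :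
    (H.induce (φ '' S)).Connected :=
  hS.map (induceHom φ (Set.mapsTo_image φ S)) (by
    rintro ⟨_, x, hx, rfl⟩
    exact ⟨⟨x, hx⟩, rfl⟩)

lemma IsK4Model.image {A : Fin 4 → Set V} (hA : IsK4Model G A) (φ : G →g H)
    (hφ : Function.Injective φ) : IsK4Model H fun i => φ '' A i where
  connected i := connected_image φ (hA.connected i)
  disjoint i j hij := (Set.disjoint_image_iff hφ).2 (hA.disjoint i j hij)
  touches i j hij :=
    let ⟨x, hx, y, hy, hxy⟩ := hA.touches i j hij
    ⟨_, ⟨x, hx, rfl⟩, _, ⟨y, hy, rfl⟩, φ.map_adj hxy⟩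

lemma isK4Model_singleton : IsK4Model K4 fun i => {i} where
  connected i := connected_singleton i
  disjoint i j hij := by simpa using hij
  touches i j hij := ⟨i, rfl, j, rfl, hij⟩

section Subdivide

variable {n : ℕ} {B : SimpleGraph (Fin n)} {u v : Fin n}

lemma subdivideEdge_adj_castSucc {a b : Fin n} (h : B.Adj a b) (h₁ : ¬(a = u ∧ b = v))
    (h₂ : ¬(a = v ∧ b = u)) : (subdivideEdge B u v).Adj a.castSucc b.castSucc := by
  rw [subdivideEdge, fromRel_adj]
  exact ⟨fun hab => h.ne (Fin.castSucc_injective n hab), Or.inl (Or.inl ⟨a, b, rfl, rfl, h, h₁, h₂⟩)⟩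

lemma subdivideEdge_adj_last {a : Fin n} (ha : a = u ∨ a = v) :
    (subdivideEdge B u v).Adj (Fin.last n) a.castSucc := by
  rw [subdivideEdge, fromRel_adj]
  refine ⟨(Fin.castSucc_lt_last a).ne', Or.inl (Or.inr ⟨rfl, ?_⟩)⟩
  rcases ha with rfl | rfl
  exacts [Or.inl rfl, Or.inr rfl]

/-- The branch set in the subdivided graph: the new vertex joins the set containing `u`. -/
def subdivideSet (u : Fin n) (S : Set (Fin n)) : Set (Fin (n + 1)) :=
  Fin.castSucc '' S ∪ {x | x = Fin.last n ∧ u ∈ S}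

lemma connected_subdivideSet {S : Set (Fin n)} (hS : (B.induce S).Connected) :
    ((subdivideEdge B u v).induce (subdivideSet u S)).Connected := by
  have hmem : ∀ {a}, a ∈ S → a.castSucc ∈ subdivideSet u S := fun ha => Or.inl ⟨_, ha, rfl⟩
  have walk : ∀ (a b : Fin n) (w : B.Walk a b), (∀ x ∈ w.support, x ∈ S) →
      ∃ P ⊆ subdivideSet u S, a.castSucc ∈ P ∧ b.castSucc ∈ P ∧
        ((subdivideEdge B u v).induce P).Connected := by
    intro a b w
    induction w with
    | nil => exact fun h => ⟨{_}, by simpa using hmem (h _ (Walk.start_mem_support _)), rfl, rfl,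
        connected_singleton _⟩
    | @cons a c b hadj w ih =>
      intro hw
      obtain ⟨P, hP, hc, hb, hconn⟩ := ih fun x hx => hw x (List.mem_cons_of_mem _ hx)
      have haS : a ∈ S := hw _ (Walk.start_mem_support _)
      have hcS : c ∈ S := hw _ (List.mem_cons_of_mem _ (Walk.start_mem_support _))
      by_cases huv : (a = u ∧ c = v) ∨ (a = v ∧ c = u)
      · have huS : u ∈ S := by rcases huv with ⟨rfl, -⟩ | ⟨-, rfl⟩ <;> assumption
        have ha : a = u ∨ a = v := by tauto
        have hc' : c = u ∨ c = v := by tauto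
        refine ⟨{a.castSucc, Fin.last n} ∪ P, ?_, by simp, Or.inr hb, ?_⟩
        · rintro x ((rfl | rfl) | hx)
          exacts [hmem haS, Or.inr ⟨rfl, huS⟩, hP hx]
        · exact connected_induce_union (v := Fin.last n)
            (induce_pair_connected_of_adj (subdivideEdge_adj_last ha).symm).preconnected
            hconn.preconnected (by simp) hc (subdivideEdge_adj_last hc')
      · push Not at huv
        refine ⟨{a.castSucc} ∪ P, Set.union_subset (by simpa using hmem haS) hP, Or.inl rfl,
          Or.inr hb, ?_⟩
        exact connected_induce_union (connected_singleton _).preconnected hconn.preconnected rfl hc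
          (subdivideEdge_adj_castSucc hadj (by tauto) (by tauto))
  have path : ∀ a ∈ S, ∀ b ∈ S, ∃ P ⊆ subdivideSet u S, a.castSucc ∈ P ∧ b.castSucc ∈ P ∧
      ((subdivideEdge B u v).induce P).Connected := by
    intro a ha b hb
    obtain ⟨P, hPS, w, -, rfl⟩ := exists_pathSet_subset hS ha hb
    exact walk a b w hPS
  obtain ⟨⟨a, ha⟩⟩ := hS.nonempty
  refine connected_of_pathSet (hmem ha) ?_
  rintro _ (⟨b, hb, rfl⟩ | ⟨rfl, hu⟩)
  · exact path a ha b hb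
  · obtain ⟨P, hP, haP, huP, hc⟩ := path a ha u hu
    refine ⟨{Fin.last n} ∪ P, Set.union_subset 
      (Set.singleton_subset_iff.2 (Or.inr ⟨rfl, hu⟩)) hP, Or.inr haP,
      Or.inl rfl, ?_⟩
    exact connected_induce_union (connected_singleton _).preconnected hc.preconnected rfl huP
      (subdivideEdge_adj_last (Or.inl rfl))

lemma IsK4Model.subdivide {A : Fin 4 → Set (Fin n)} (hA : IsK4Model B A) (u v : Fin n) :
    IsK4Model (subdivideEdge B u v) fun i => subdivideSet u (A i) where
  connected i := connected_subdivideSet (hA.connected i)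
  disjoint i j hij := by
    have hd := Set.disjoint_left.1 (hA.disjoint i j hij)
    rw [Set.disjoint_left]
    rintro _ (⟨a, ha, rfl⟩ | ⟨rfl, hu⟩) (⟨b, hb, hab⟩ | ⟨hl, hu'⟩)
    · exact hd ha (Fin.castSucc_injective n hab ▸ hb)
    · exact (Fin.castSucc_lt_last a).ne hl
    · exact (Fin.castSucc_lt_last b).ne hab
    · exact hd hu hu'
  touches i j hij := by
    obtain ⟨x, hx, y, hy, hxy⟩ := hA.touches i j hij
    by_cases h₁ : x = u ∧ y = v
    · exact ⟨_, Or.inr ⟨rfl, h₁.1 ▸ hx⟩, _, Or.inl ⟨y, hy, rfl⟩,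
        subdivideEdge_adj_last (Or.inr h₁.2)⟩
    by_cases h₂ : x = v ∧ y = u
    · exact ⟨_, Or.inl ⟨x, hx, rfl⟩, _, Or.inr ⟨rfl, h₂.2 ▸ hy⟩,
        (subdivideEdge_adj_last (Or.inr h₂.1)).symm⟩
    exact ⟨_, Or.inl ⟨x, hx, rfl⟩, _, Or.inl ⟨y, hy, rfl⟩, subdivideEdge_adj_castSucc hxy h₁ h₂⟩

end Subdivide

lemma IsSubdivision.exists_isK4Model (h : IsSubdivision G K4) : ∃ A, IsK4Model G A := by
  obtain ⟨C, B, ⟨e⟩, ⟨f⟩, hCB⟩ := h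
  have hC : ∃ A, IsK4Model C.2 A := by
    clear e
    induction hCB using Relation.ReflTransGen.head_induction_on with
    | refl => exact ⟨_, isK4Model_singleton.image f.toHom f.injective⟩
    | head hstep _ ih =>
      obtain ⟨B, u, v, -⟩ := hstep
      obtain ⟨A, hA⟩ := ih
      exact ⟨_, hA.subdivide u v⟩
  obtain ⟨A, hA⟩ := hC
  exact ⟨_, hA.image e.symm.toHom e.symm.injective⟩

lemma HasProperK4Subdivision.exists_isK4Model (h : HasProperK4Subdivision G) :
    ∃ A v, IsK4Model G A ∧ v ∉ ⋃ i, A i := by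
  obtain ⟨v, S, hS⟩ := h
  obtain ⟨A, hA⟩ := hS.exists_isK4Model
  refine ⟨_, v, (hA.image S.hom S.hom_injective).image (Embedding.induce _).toHom
    Subtype.val_injective, ?_⟩
  simp only [Set.mem_iUnion, not_exists]
  rintro i ⟨x, -, hx⟩
  exact x.2 hx

end Model

section MinimalModel

variable {V : Type*} {G : SimpleGraph V}

/-- A `K₄`-model with the fewest vertices. -/
structure IsMinK4Model (G : SimpleGraph V) (A : Fin 4 → Set V) : Prop extends IsK4Model G A where
  le_ncard : ∀ B, IsK4Model G B → (⋃ i, A i).ncard ≤ (⋃ i, B i).ncard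

lemma IsK4Model.exists_isMinK4Model {A : Fin 4 → Set V} (hA : IsK4Model G A) :
    ∃ B, IsMinK4Model G B ∧ (⋃ i, B i).ncard ≤ (⋃ i, A i).ncard := by
  obtain ⟨B, hB, hmin⟩ := WellFounded.has_min
    (InvImage.wf (fun B : Fin 4 → Set V => (⋃ i, B i).ncard) wellFounded_lt)
    {B | IsK4Model G B} ⟨A, hA⟩
  exact ⟨B, ⟨hB, fun C hC => not_lt.1 (hmin C hC)⟩, not_lt.1 (hmin A hA)⟩

lemma IsMinK4Model.not_ssubset [Finite V] {A B : Fin 4 → Set V} (hA : IsMinK4Model G A)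
    (hB : IsK4Model G B) : ¬ (⋃ i, B i) ⊂ ⋃ i, A i :=
  fun h => (Set.ncard_lt_ncard h).not_ge (hA.le_ncard B hB)

/-- Shrinking a branch set of a minimal model to a subset that still touches all the others is
impossible. -/
lemma IsMinK4Model.eq_of_subset [Finite V] {A : Fin 4 → Set V} (hA : IsMinK4Model G A)
    {i : Fin 4} {S : Set V} (hS : S ⊆ A i) (hc : (G.induce S).Connected)
    (ht : ∀ j, j ≠ i → Touches G S (A j)) : S = A i := by
  classical
  refine hS.antisymm fun x hx => ?_
  by_contra hxS
  have hsub : ∀ k, Function.update A i S k ⊆ A k := by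
    intro k
    by_cases hk : k = i
    · subst hk
      simpa using hS
    · simp [hk]
  refine hA.not_ssubset (B := Function.update A i S) ⟨?_, ?_, ?_⟩
    ⟨Set.iUnion_mono hsub, fun h => ?_⟩
  · intro k
    by_cases hk : k = i
    · subst hk
      rwa [Function.update_self]
    · rw [Function.update_of_ne hk]
      exact hA.connected k
  · exact fun k l hkl => (hA.disjoint k l hkl).mono (hsub k) (hsub l)
  · intro k l hkl
    by_cases hk : k = i
    · subst hk
      simpa [hkl.symm] using ht l hkl.symm
    · by_cases hl : l = i
      · subst hl
        simpa [hk] using (ht k hk).symm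
      · simpa [hk, hl] using hA.touches k l hkl
  · obtain ⟨k, hk⟩ := Set.mem_iUnion.1 (h (Set.mem_iUnion.2 ⟨i, hx⟩))
    by_cases hki : k = i
    · subst hki
      simp only [Function.update_self] at hk
      exact hxS hk
    · exact Set.disjoint_left.1 (hA.disjoint k i hki) (hsub k hk) hx

/-- Moving a connected part of a branch set to another branch set. -/
lemma IsK4Model.transfer {A : Fin 4 → Set V} (hA : IsK4Model G A) {i j : Fin 4} (hij : j ≠ i)
    {S T : Set V} (hST : S ∪ T = A i) (hd : Disjoint S T) (hS : (G.induce S).Connected)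
    (hT : (G.induce T).Connected) (hTS : Touches G S T) (hTj : Touches G T (A j))
    (ht : ∀ k, k ≠ i → k ≠ j → Touches G S (A k)) :
    ∃ B, IsK4Model G B ∧ (⋃ k, B k) = (⋃ k, A k) ∧ S ⊆ B i ∧ T ⊆ B j := by
  classical
  have hSi : S ⊆ A i := hST ▸ Set.subset_union_left
  have hTi : T ⊆ A i := hST ▸ Set.subset_union_right
  let B : Fin 4 → Set V := fun k => if k = i then S else if k = j then A j ∪ T else A k
  have hBi : B i = S := if_pos rfl
  have hBj : B j = A j ∪ T := by simp [B, hij]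
  have hBk : ∀ k, k ≠ i → k ≠ j → B k = A k := fun k h h' => by simp [B, h, h']
  have hSj : Disjoint S (A j) := (hA.disjoint i j hij.symm).mono_left hSi
  have hBmono : ∀ k, k ≠ i → A k ⊆ B k := by
    intro k hk
    by_cases hkj : k = j
    · subst hkj
      exact hBj ▸ Set.subset_union_left
    · exact (hBk k hk hkj).ge
  have htS : ∀ k, k ≠ i → Touches G S (B k) := by
    intro k hk
    by_cases hkj : k = j
    · subst hkj
      exact hTS.mono subset_rfl (hBj ▸ Set.subset_union_right)
    · exact (hBk k hk hkj).symm ▸ ht k hk hkj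
  have hdS : ∀ k, k ≠ i → Disjoint S (B k) := by
    intro k hk
    by_cases hkj : k = j
    · subst hkj
      exact hBj ▸ Set.disjoint_union_right.2 ⟨hSj, hd⟩
    · exact (hBk k hk hkj).symm ▸ (hA.disjoint i k hk.symm).mono_left hSi
  have hdj : ∀ k, k ≠ i → k ≠ j → Disjoint (B j) (B k) := by
    intro k hk hkj
    rw [hBj, hBk k hk hkj]
    exact Set.disjoint_union_left.2
      ⟨hA.disjoint j k hkj.symm, (hA.disjoint i k hk.symm).mono_left hTi⟩
  refine ⟨B, ⟨?_, ?_, ?_⟩, ?_, hBi.ge, hBj ▸ Set.subset_union_right⟩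
  · intro k
    by_cases hk : k = i
    · subst hk
      rwa [hBi]
    by_cases hkj : k = j
    · subst hkj
      obtain ⟨x, hx, y, hy, hxy⟩ := hTj.symm
      rw [hBj]
      exact connected_induce_union (hA.connected k).preconnected hT.preconnected hx hy hxy
    · rw [hBk k hk hkj]
      exact hA.connected k
  · intro k l hkl
    by_cases hk : k = i
    · subst hk
      exact hBi.symm ▸ hdS l hkl.symm
    by_cases hl : l = i
    · subst hl
      exact hBi.symm ▸ (hdS k hk).symm
    by_cases hkj : k = j
    · subst hkj
      exact hdj l hl hkl.symm
    by_cases hlj : l = j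
    · subst hlj
      exact (hdj k hk hkl).symm
    rw [hBk k hk hkj, hBk l hl hlj]
    exact hA.disjoint k l hkl
  · intro k l hkl
    by_cases hk : k = i
    · subst hk
      exact hBi.symm ▸ htS l hkl.symm
    by_cases hl : l = i
    · subst hl
      exact hBi.symm ▸ (htS k hk).symm
    exact (hA.touches k l hkl).mono (hBmono k hk) (hBmono l hl)
  · ext x
    simp only [Set.mem_iUnion]
    constructor
    · rintro ⟨k, hk⟩
      by_cases hki : k = i
      · subst hki
        exact ⟨k, hSi (hBi ▸ hk)⟩
      by_cases hkj : k = j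
      · subst hkj
        rw [hBj] at hk
        exact hk.elim (fun h => ⟨k, h⟩) fun h => ⟨i, hTi h⟩
      · exact ⟨k, hBk k hki hkj ▸ hk⟩
    · rintro ⟨k, hk⟩
      by_cases hki : k = i
      · subst hki
        rw [← hST] at hk
        exact hk.elim (fun h => ⟨k, hBi.symm ▸ h⟩) fun h => ⟨j, hBj.symm ▸ Or.inr h⟩
      · exact ⟨k, hBmono k hki hk⟩

/-- If each of three indices satisfies `a` or `b`, but not all satisfy `a` and not all satisfy
`b`, then one property holds at all but one of them, where the other holds. -/
lemma exists_index_of_or (i : Fin 4) (a b : Fin 4 → Prop) (h : ∀ k, k ≠ i → a k ∨ b k)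
    (ha : ¬ ∀ k, k ≠ i → a k) (hb : ¬ ∀ k, k ≠ i → b k) :
    (∃ j, j ≠ i ∧ b j ∧ ∀ k, k ≠ i → k ≠ j → a k) ∨
      ∃ j, j ≠ i ∧ a j ∧ ∀ k, k ≠ i → k ≠ j → b k := by
  push Not at ha hb
  obtain ⟨k, hki, hk⟩ := ha
  obtain ⟨l, hli, hl⟩ := hb
  have hbk := (h k hki).resolve_left hk
  have hal := (h l hli).resolve_right hl
  have hkl : k ≠ l := fun e => hl (e ▸ hbk)
  obtain ⟨m, hmi, hmk, hml⟩ : ∃ m : Fin 4, m ≠ i ∧ m ≠ k ∧ m ≠ l := by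
    clear * -
    decide +revert
  have huniv : ∀ n, n ≠ i → n = k ∨ n = l ∨ n = m := by
    clear * - hki hli hkl hmi hmk hml
    omega
  rcases h m hmi with hm | hm
  · refine Or.inl ⟨k, hki, hbk, fun n hn hnk => ?_⟩
    rcases huniv n hn with rfl | rfl | rfl
    exacts [absurd rfl hnk, hal, hm]
  · refine Or.inr ⟨l, hli, hal, fun n hn hnl => ?_⟩
    rcases huniv n hn with rfl | rfl | rfl
    exacts [hbk, absurd rfl hnl, hm]

/-- Two vertices of a minimal model can be placed in distinct branch sets. -/
lemma IsMinK4Model.exists_separating [Finite V] {A : Fin 4 → Set V} (hA : IsMinK4Model G A)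
    {p q : V} (hp : p ∈ ⋃ i, A i) (hq : q ∈ ⋃ i, A i) (hpq : p ≠ q) :
    ∃ B, IsK4Model G B ∧ (⋃ k, B k) = (⋃ k, A k) ∧ ∃ i j, i ≠ j ∧ p ∈ B i ∧ q ∈ B j := by
  obtain ⟨i, hpi⟩ := Set.mem_iUnion.1 hp
  obtain ⟨j, hqj⟩ := Set.mem_iUnion.1 hq
  by_cases hij : i = j
  swap
  · exact ⟨A, hA.toIsK4Model, rfl, i, j, hij, hpi, hqj⟩
  subst hij
  obtain ⟨S, T, hS, hT, hpS, hqT, hU, hd, hST⟩ :=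
    exists_connected_split (hA.connected i) hpi hqj hpq
  have hSA : S ⊆ A i := hU ▸ Set.subset_union_left
  have hTA : T ⊆ A i := hU ▸ Set.subset_union_right
  rcases exists_index_of_or i (fun k => Touches G S (A k)) (fun k => Touches G T (A k))
    (fun k hk => Touches.of_union_left (hU.symm ▸ hA.touches i k hk.symm))
    (fun h => Set.disjoint_left.1 hd ((hA.eq_of_subset hSA hS h).symm ▸ hqj) hqT)
    (fun h => Set.disjoint_left.1 hd hpS ((hA.eq_of_subset hTA hT h).symm ▸ hpi)) with
    ⟨j, hji, hj, hk⟩ | ⟨j, hji, hj, hk⟩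
  · obtain ⟨B, hB, hBU, hBi, hBj⟩ := hA.transfer hji hU hd hS hT hST hj hk
    exact ⟨B, hB, hBU, i, j, hji.symm, hBi hpS, hBj hqT⟩
  · obtain ⟨B, hB, hBU, hBi, hBj⟩ := hA.transfer hji (Set.union_comm S T ▸ hU) hd.symm hT hS
      (Touches.symm hST) hj hk
    exact ⟨B, hB, hBU, j, i, hji, hBj hpS, hBi hqT⟩

/-- A connected set attached to a `K₄`-model at two vertices of distinct branch sets gives
`K̂₄`. -/
lemma IsK4Model.isInducedMinor_hatK4 {A : Fin 4 → Set V} (hA : IsK4Model G A) {D : Set V}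
    (hD : (G.induce D).Connected) (hdisj : Disjoint D (⋃ k, A k)) {p q : V} {i j : Fin 4}
    (hij : i ≠ j) (hp : p ∈ A i) (hq : q ∈ A j) (hDp : Touches G D {p}) (hDq : Touches G D {q})
    (honly : ∀ x ∈ D, ∀ y ∈ ⋃ k, A k, G.Adj x y → y = p ∨ y = q) :
    IsInducedMinor hatK4 G := by
  obtain ⟨σ, hσ0, hσ1⟩ : ∃ σ : Equiv.Perm (Fin 4), σ 0 = i ∧ σ 1 = j := by
    clear * - hij
    decide +revert
  have hDk : ∀ k, Touches G D (A (σ k)) ↔ k = 0 ∨ k = 1 := by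
    intro k
    constructor
    · rintro ⟨x, hx, y, hy, hxy⟩
      have hmem : ∀ {l}, y ∈ A l → l = σ k := fun {l} hl => by
        by_contra hne
        exact Set.disjoint_left.1 (hA.disjoint l _ hne) hl hy
      rcases honly x hx y (Set.mem_iUnion.2 ⟨_, hy⟩) hxy with rfl | rfl
      · exact Or.inl (σ.injective (hσ0.trans (hmem hp))).symm
      · exact Or.inr (σ.injective (hσ1.trans (hmem hq))).symm
    · rintro (rfl | rfl)
      · exact hDp.mono subset_rfl (by simpa [hσ0] using hp)
      · exact hDq.mono subset_rfl (by simpa [hσ1] using hq)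
  have hDA : ∀ k, Disjoint D (A k) := fun k => hdisj.mono_right (Set.subset_iUnion A k)
  have hDadj : ∀ k : Fin 4, hatK4.Adj k.castSucc (Fin.last 4) ↔ k = 0 ∨ k = 1 := by
    simp only [hatK4, fromRel_adj]
    decide
  have hAadj : ∀ k l : Fin 4, k ≠ l → hatK4.Adj k.castSucc l.castSucc := by
    simp only [hatK4, fromRel_adj]
    decide
  obtain ⟨μ, hμl, hμc⟩ : ∃ μ : Fin 5 → Set V, μ (Fin.last 4) = D ∧
      ∀ k : Fin 4, μ k.castSucc = A (σ k) :=
    ⟨Fin.lastCases (motive := fun _ => Set V) D fun k => A (σ k), Fin.lastCases_last,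
      fun k => Fin.lastCases_castSucc k⟩
  refine ⟨μ, ?_, ?_, ?_, ?_⟩
  · intro k
    cases k using Fin.lastCases with
    | last => exact hμl ▸ Set.nonempty_coe_sort.1 hD.nonempty
    | cast k => exact hμc k ▸ Set.nonempty_coe_sort.1 (hA.connected (σ k)).nonempty
  · intro k l hkl
    cases k using Fin.lastCases with
    | last =>
      cases l using Fin.lastCases with
      | last => exact absurd rfl hkl
      | cast l => rw [hμl, hμc]; exact hDA (σ l)
    | cast k =>
      cases l using Fin.lastCases with
      | last => rw [hμl, hμc]; exact (hDA (σ k)).symm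
      | cast l =>
        rw [hμc, hμc]
        exact hA.disjoint (σ k) (σ l) (σ.injective.ne fun h => hkl (congrArg _ h))
  · intro k
    cases k using Fin.lastCases with
    | last => rwa [hμl]
    | cast k => rw [hμc]; exact hA.connected (σ k)
  · intro k l hkl
    cases k using Fin.lastCases with
    | last =>
      cases l using Fin.lastCases with
      | last => exact absurd rfl hkl
      | cast l =>
        rw [hatK4.adj_comm, hDadj, ← hDk, hμl, hμc]
        exact Iff.rfl
    | cast k =>
      cases l using Fin.lastCases with
      | last =>
        rw [hDadj, ← hDk, hμl, hμc]
        exact ⟨Touches.symm, Touches.symm⟩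
      | cast l =>
        have hne : k ≠ l := fun h => hkl (congrArg _ h)
        rw [hμc, hμc]
        exact iff_of_true (hA.touches _ _ (σ.injective.ne hne)) (hAadj k l hne)

end MinimalModel

section Attachment

variable {V : Type*} {G : SimpleGraph V}

/-- In a 2-connected graph, a set missing a vertex has a connected set outside of it with at
least two attachments. -/
lemma TwoConnected.exists_two_attachments [Fintype V] (h2 : TwoConnected G) {M : Set V}
    (hM : M.Nontrivial) {v : V} (hv : v ∉ M) :
    ∃ D, (G.induce D).Connected ∧ Disjoint D M ∧ {p ∈ M | Touches G D {p}}.Nontrivial := by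
  obtain ⟨D, hD⟩ := (Set.toFinite {D : Set V | Disjoint D M ∧ v ∈ D ∧
    (G.induce D).Connected}).exists_maximal
    ⟨{v}, by simpa using hv, rfl, connected_singleton v⟩
  obtain ⟨hDM, hvD, hDc⟩ := hD.prop
  refine ⟨D, hDc, hDM, ?_⟩
  by_contra hsub
  rw [Set.not_nontrivial_iff] at hsub
  obtain ⟨p, hpM, hp⟩ : ∃ p ∈ M, ∀ q ∈ M, Touches G D {q} → q = p := by
    by_cases hex : ∃ p ∈ M, Touches G D {p}
    · obtain ⟨p, hp⟩ := hex
      exact ⟨p, hp.1, fun q hq hq' => hsub ⟨hq, hq'⟩ hp⟩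
    · push Not at hex
      obtain ⟨p, hp⟩ := hM.nonempty
      exact ⟨p, hp, fun q hq hq' => absurd hq' (hex q hq)⟩
  obtain ⟨q, hqM, hqp⟩ := hM.exists_ne p
  obtain ⟨P, hP, w, -, rfl⟩ := exists_pathSet_subset (h2.2 p) (x := v) (y := q)
    (fun h => hv (h ▸ hpM)) hqp
  obtain ⟨e, he, h₁, h₂⟩ := w.exists_boundary_dart D hvD
    (fun h => Set.disjoint_left.1 hDM h hqM)
  have hne : e.snd ≠ p := hP (w.dart_snd_mem_support_of_mem_darts he)
  by_cases heM : e.snd ∈ M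
  · exact hne (hp _ heM ⟨e.fst, h₁, e.snd, rfl, e.adj⟩)
  · refine h₂ (hD.le_of_ge (y := {e.snd} ∪ D) ⟨?_, Or.inr hvD, ?_⟩ Set.subset_union_right
      (Or.inl rfl))
    · exact Set.disjoint_union_left.2 ⟨by simpa using heM, hDM⟩
    · exact connected_induce_union (connected_singleton _).preconnected hDc.preconnected rfl h₁
        e.adj.symm

/-- In a 2-connected graph, outside of a set missing a vertex there is a connected set with
exactly two attachments, or a vertex with at least three neighbours in the set. -/
lemma TwoConnected.exists_attachment [Fintype V] (h2 : TwoConnected G) {M : Set V}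
    (hM : M.Nontrivial) {v : V} (hv : v ∉ M) :
    (∃ D, (G.induce D).Connected ∧ Disjoint D M ∧ ∃ p ∈ M, ∃ q ∈ M, p ≠ q ∧ Touches G D {p} ∧
      Touches G D {q} ∧ ∀ x ∈ D, ∀ y ∈ M, G.Adj x y → y = p ∨ y = q) ∨
    ∃ d ∉ M, ∃ x ∈ M, ∃ y ∈ M, ∃ z ∈ M, x ≠ y ∧ x ≠ z ∧ y ≠ z ∧
      G.Adj d x ∧ G.Adj d y ∧ G.Adj d z := by
  obtain ⟨D, hD, hmin⟩ := WellFounded.has_min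
    (InvImage.wf (fun D : Set V => D.ncard) wellFounded_lt)
    {D | (G.induce D).Connected ∧ Disjoint D M ∧ {p ∈ M | Touches G D {p}}.Nontrivial}
    (h2.exists_two_attachments hM hv)
  obtain ⟨hDc, hDM, p, ⟨hpM, hp⟩, q, ⟨hqM, hq⟩, hpq⟩ := hD
  by_cases honly : ∀ x ∈ D, ∀ y ∈ M, G.Adj x y → y = p ∨ y = q
  · exact Or.inl ⟨D, hDc, hDM, p, hpM, q, hqM, hpq, hp, hq, honly⟩
  right
  push Not at honly
  obtain ⟨x, hx, r, hrM, hxr, hrp, hrq⟩ := honly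
  by_cases hsing : D.Subsingleton
  · obtain rfl : D = {x} := hsing.eq_singleton_of_mem hx
    have hadj : ∀ {y}, Touches G {x} {y} → G.Adj x y := by
      rintro y ⟨_, rfl, _, rfl, h⟩
      exact h
    exact ⟨x, by simpa using hDM, p, hpM, q, hqM, r, hrM, hpq, hrp.symm, hrq.symm, hadj hp,
      hadj hq, hxr⟩
  · exfalso
    rw [Set.not_subsingleton_iff] at hsing
    obtain ⟨s, hs, t, ht, hst⟩ := hsing
    obtain ⟨S, T, hS, hT, hsS, htT, hU, hd, -⟩ := exists_connected_split hDc hs ht hst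
    have hsmall : ∀ R ⊂ D, (G.induce R).Connected → {p ∈ M | Touches G R {p}}.Subsingleton := by
      intro R hR hRc
      rw [← Set.not_nontrivial_iff]
      intro hn
      exact hmin R ⟨hRc, hDM.mono_left hR.subset, hn⟩ (Set.ncard_lt_ncard hR)
    have hS' := hsmall S ⟨hU ▸ Set.subset_union_left,
      fun h => Set.disjoint_left.1 hd (h ht) htT⟩ hS
    have hT' := hsmall T ⟨hU ▸ Set.subset_union_right,
      fun h => Set.disjoint_left.1 hd hsS (h hs)⟩ hT
    have hr : Touches G D {r} := ⟨x, hx, r, rfl, hxr⟩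
    rw [← hU] at hp hq hr
    have key : ∀ {a b}, a ∈ M → b ∈ M → a ≠ b →
        ¬(Touches G S {a} ∧ Touches G S {b}) ∧ ¬(Touches G T {a} ∧ Touches G T {b}) :=
      fun ha hb hab => ⟨fun h => hab (hS' ⟨ha, h.1⟩ ⟨hb, h.2⟩),
        fun h => hab (hT' ⟨ha, h.1⟩ ⟨hb, h.2⟩)⟩
    have h₁ := key hpM hqM hpq
    have h₂ := key hrM hpM hrp
    have h₃ := key hrM hqM hrq
    have := hp.of_union_left
    have := hq.of_union_left
    have := hr.of_union_left
    tauto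

end Attachment

section Subdivision

variable {V : Type*} {G : SimpleGraph V}

/-- A cycle through three neighbours of a vertex outside of it gives a 3-wheel. -/
lemma nonempty_threeWheelSub {b d x y z : V} {c : G.Walk b b} (hc : c.IsCycle)
    (hd : d ∉ c.support) (hx : x ∈ c.support) (hy : y ∈ c.support) (hz : z ∈ c.support)
    (hxy : x ≠ y) (hxz : x ≠ z) (hyz : y ≠ z) (hdx : G.Adj d x) (hdy : G.Adj d y)
    (hdz : G.Adj d z) : Nonempty (ThreeWheelSub G) := by
  classical
  exact ⟨{
    base := b
    cyc := c
    cyc_isCycle := hc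
    center := d
    center_not_mem := hd
    spokes := {x, y, z}
    spokes_card := Finset.card_eq_three.2 ⟨x, y, z, hxy, hxz, hyz, rfl⟩
    spokes_sub := by simp [hx, hy, hz]
    spokes_adj := by simp [hdx, hdy, hdz] }⟩

/-- The sets `E i j` are the vertex sets of the paths of a subdivision of `K₄` with branch
vertices `f i`. -/
structure IsK4Paths (G : SimpleGraph V) (f : Fin 4 → V) (E : Fin 4 → Fin 4 → Set V) : Prop where
  injective : Function.Injective f
  path : ∀ i j, i ≠ j → PathSet G (f i) (f j) (E i j)
  symm : ∀ i j, E i j = E j i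
  eq_of_mem : ∀ i j k, i ≠ j → i ≠ k → j ≠ k → ∀ x ∈ E i j, x ∈ E i k → x = f i
  notMem : ∀ i j k l, i ≠ j → i ≠ k → i ≠ l → j ≠ k → j ≠ l → k ≠ l → ∀ x ∈ E i j, x ∉ E k l

/-- A connected set contains a tripod ending at three given vertices, indexed by the elements of
`Fin 4` other than `i`. -/
lemma exists_tripod_ne {S : Set V} (hS : (G.induce S).Connected) (i : Fin 4) (c : Fin 4 → V)
    (hc : ∀ j, j ≠ i → c j ∈ S) :
    ∃ m ∈ S, ∃ L : Fin 4 → Set V, ∀ j, j ≠ i → L j ⊆ S ∧ PathSet G m (c j) (L j) ∧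
      ∀ k, k ≠ i → j ≠ k → L j ∩ L k ⊆ {m} := by
  obtain ⟨m, hm, L, hL, hp, hI⟩ := exists_tripod hS (fun k => c (i.succAbove k))
    fun k => hc _ (Fin.succAbove_ne i k)
  refine ⟨m, hm, i.insertNth (α := fun _ => Set V) ∅ L, fun j hj => ?_⟩
  obtain ⟨j, rfl⟩ := Fin.exists_succAbove_eq hj
  rw [Fin.insertNth_apply_succAbove]
  refine ⟨hL j, hp j, fun k hk hjk => ?_⟩
  obtain ⟨k, rfl⟩ := Fin.exists_succAbove_eq hk
  rw [Fin.insertNth_apply_succAbove]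
  exact hI j k fun h => hjk (congrArg _ h)

/-- The branch sets of a minimal `K₄`-model are covered by the paths of a subdivision of `K₄`. -/
lemma IsMinK4Model.exists_isK4Paths [Finite V] {A : Fin 4 → Set V} (hA : IsMinK4Model G A) :
    ∃ f E, IsK4Paths G f E ∧ (∀ i j, i ≠ j → E i j ⊆ ⋃ k, A k) ∧
      ∀ x ∈ ⋃ k, A k, ∃ i j, i ≠ j ∧ x ∈ E i j := by
  have hex : ∀ i j, ∃ x y, i ≠ j → x ∈ A i ∧ y ∈ A j ∧ G.Adj x y := by
    intro i j
    by_cases hij : i = j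
    · obtain ⟨x⟩ := (hA.connected i).nonempty
      exact ⟨x, x, fun h => absurd hij h⟩
    · obtain ⟨x, hx, y, hy, hxy⟩ := hA.touches i j hij
      exact ⟨x, y, fun _ => ⟨hx, hy, hxy⟩⟩
  choose X Y hXY using hex
  obtain ⟨c, hc, hcadj⟩ : ∃ c : Fin 4 → Fin 4 → V, (∀ i j, j ≠ i → c i j ∈ A i) ∧
      ∀ i j, i ≠ j → G.Adj (c i j) (c j i) := by
    refine ⟨fun i j => if i < j then X i j else Y j i, fun i j hij => ?_, fun i j hij => ?_⟩
    · rcases hij.lt_or_gt with h | h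
      · simpa [h.not_gt] using (hXY j i hij).2.1
      · simpa [h] using (hXY i j hij.symm).1
    · rcases hij.lt_or_gt with h | h
      · simpa [h, h.not_gt] using (hXY i j hij).2.2
      · simpa [h, h.not_gt] using (hXY j i hij.symm).2.2.symm
  choose f hf L hL using fun i => exists_tripod_ne (hA.connected i) i (c i) (hc i)
  have hLA : ∀ i j, j ≠ i → L i j ⊆ A i := fun i j h => (hL i j h).1
  have hLp : ∀ i j, j ≠ i → PathSet G (f i) (c i j) (L i j) := fun i j h => (hL i j h).2.1
  have hLI : ∀ i j k, j ≠ i → k ≠ i → j ≠ k → ∀ x ∈ L i j, x ∈ L i k → x = f i :=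
    fun i j k h h' hjk x hx hx' => (hL i j h).2.2 k h' hjk ⟨hx, hx'⟩
  have hAd : ∀ {i j x}, x ∈ A i → x ∈ A j → i = j := by
    intro i j x hi hj
    by_contra hij
    exact Set.disjoint_left.1 (hA.disjoint i j hij) hi hj
  refine ⟨f, fun i j => L i j ∪ L j i, ⟨?_, ?_, ?_, ?_, ?_⟩, ?_, ?_⟩
  · intro i j hij
    exact hAd (hf i) (hij ▸ hf j)
  · intro i j hij
    have hi := hLp i j hij.symm
    have hj := hLp j i hij
    have h₁ := hi.trans (.pair (hcadj i j hij)) (by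
      rintro x ⟨hx, rfl | rfl⟩
      · rfl
      · exact absurd (hAd (hLA i j hij.symm hx) (hc j i hij)) hij)
    have h₂ := h₁.trans hj.symm (by
      rintro x ⟨hx | rfl | rfl, hx'⟩
      · exact absurd (hAd (hLA i j hij.symm hx) (hLA j i hij hx')) hij
      · exact absurd (hAd (hc i j hij.symm) (hLA j i hij hx')) hij
      · rfl)
    convert h₂ using 1
    have := hi.right_mem
    have := hj.right_mem
    ext x
    simp only [Set.mem_union, Set.mem_insert_iff, Set.mem_singleton_iff]
    constructor
    · tauto
    · rintro ((h | rfl | rfl) | h) <;> tauto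
  · exact fun i j => Set.union_comm _ _
  · rintro i j k hij hik hjk x (hx | hx) (hx' | hx')
    · exact hLI i j k hij.symm hik.symm hjk x hx hx'
    · exact absurd (hAd (hLA i j hij.symm hx) (hLA k i hik hx')) hik
    · exact absurd (hAd (hLA j i hij hx) (hLA i k hik.symm hx')) hij.symm
    · exact absurd (hAd (hLA j i hij hx) (hLA k i hik hx')) hjk
  · rintro i j k l hij hik hil hjk hjl hkl x (hx | hx) (hx' | hx')
    · exact hik (hAd (hLA i j hij.symm hx) (hLA k l hkl.symm hx'))
    · exact hil (hAd (hLA i j hij.symm hx) (hLA l k hkl hx'))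
    · exact hjk (hAd (hLA j i hij hx) (hLA k l hkl.symm hx'))
    · exact hjl (hAd (hLA j i hij hx) (hLA l k hkl hx'))
  · exact fun i j hij => Set.union_subset
      ((hLA i j hij.symm).trans (Set.subset_iUnion A i)) ((hLA j i hij).trans (Set.subset_iUnion A j))
  · intro x hx
    obtain ⟨i, hx⟩ := Set.mem_iUnion.1 hx
    have hmem : ∀ {j y}, j ≠ i → y ∈ L i j → y ∈ ⋃ j, ⋃ _ : j ≠ i, L i j := fun hj hy =>
      Set.mem_iUnion₂.2 ⟨_, hj, hy⟩
    have hcov : (⋃ j, ⋃ _ : j ≠ i, L i j) = A i := by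
      obtain ⟨k, hk⟩ := exists_ne i
      refine hA.eq_of_subset (Set.iUnion₂_subset fun j hj => hLA i j hj) ?_ fun j hj =>
        ⟨c i j, hmem hj (hLp i j hj).right_mem, c j i, hc j i hj.symm, hcadj i j hj.symm⟩
      refine connected_of_pathSet (hmem hk (hLp i k hk).left_mem) fun y hy => ?_
      obtain ⟨j, hj, hy⟩ := Set.mem_iUnion₂.1 hy
      exact ⟨L i j, fun z hz => hmem hj hz, (hLp i j hj).left_mem, hy, (hLp i j hj).connected⟩
    rw [← hcov] at hx
    obtain ⟨j, hj, hx⟩ := Set.mem_iUnion₂.1 hx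
    exact ⟨i, j, hj.symm, Or.inl hx⟩

end Subdivision

section Wheel

variable {V : Type*} {G : SimpleGraph V} {f : Fin 4 → V} {E : Fin 4 → Fin 4 → Set V}

namespace IsK4Paths

lemma left_mem (h : IsK4Paths G f E) {i j : Fin 4} (hij : i ≠ j) : f i ∈ E i j :=
  (h.path i j hij).left_mem

lemma right_mem (h : IsK4Paths G f E) {i j : Fin 4} (hij : i ≠ j) : f j ∈ E i j :=
  (h.path i j hij).right_mem

lemma branch_notMem (h : IsK4Paths G f E) {i j k : Fin 4} (hij : i ≠ j) (hik : i ≠ k)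
    (hjk : j ≠ k) : f k ∉ E i j := by
  obtain ⟨l, hil, hjl, hkl⟩ : ∃ l, i ≠ l ∧ j ≠ l ∧ k ≠ l := by decide +revert
  exact fun hk => h.notMem i j k l hij hik hil hjk hjl hkl _ hk (h.left_mem hkl)

lemma wheel_of_triangle (h : IsK4Paths G f E) {a b c : Fin 4} (hab : a ≠ b) (hac : a ≠ c)
    (hbc : b ≠ c) {d x y z : V} (hd : ∀ i j, i ≠ j → d ∉ E i j)
    (hx : x ∈ E a b ∪ E b c ∪ E a c) (hy : y ∈ E a b ∪ E b c ∪ E a c)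
    (hz : z ∈ E a b ∪ E b c ∪ E a c)
    (hxy : x ≠ y) (hxz : x ≠ z) (hyz : y ≠ z) (hdx : G.Adj d x) (hdy : G.Adj d y)
    (hdz : G.Adj d z) : Nonempty (ThreeWheelSub G) := by
  have i₁ := h.eq_of_mem b a c hab.symm hbc hac
  have i₂ := h.eq_of_mem a b c hab hac hbc
  have i₃ := h.eq_of_mem c a b hac.symm hbc.symm hab
  have hP := (h.path a b hab).trans (h.path b c hbc) fun v hv =>
    i₁ v (h.symm a b ▸ hv.1) hv.2
  obtain ⟨q, hq, hs⟩ := hP.exists_isCycle (h.path a c hac).symm (by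
    rintro v ⟨hv | hv, hv'⟩
    · exact Or.inl (i₂ v hv hv')
    · exact Or.inr (i₃ v (h.symm a c ▸ hv') (h.symm b c ▸ hv)))
    (Or.inr (h.left_mem hbc)) (h.injective.ne hab.symm) (h.injective.ne hbc)
  refine nonempty_threeWheelSub hq ?_ ((hs _).2 hx) ((hs _).2 hy) ((hs _).2 hz)
    hxy hxz hyz hdx hdy hdz
  rw [hs]
  rintro ((hv | hv) | hv)
  exacts [hd a b hab hv, hd b c hbc hv, hd a c hac hv]

lemma wheel_of_square (h : IsK4Paths G f E) {a b c e : Fin 4} (hab : a ≠ b) (hac : a ≠ c)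
    (hae : a ≠ e) (hbc : b ≠ c) (hbe : b ≠ e) (hce : c ≠ e) {d x y z : V}
    (hd : ∀ i j, i ≠ j → d ∉ E i j)
    (hx : x ∈ E a b ∪ E b c ∪ (E c e ∪ E e a)) (hy : y ∈ E a b ∪ E b c ∪ (E c e ∪ E e a))
    (hz : z ∈ E a b ∪ E b c ∪ (E c e ∪ E e a))
    (hxy : x ≠ y) (hxz : x ≠ z) (hyz : y ≠ z) (hdx : G.Adj d x) (hdy : G.Adj d y)
    (hdz : G.Adj d z) : Nonempty (ThreeWheelSub G) := by
  have i₁ := h.eq_of_mem b a c hab.symm hbc hac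
  have i₂ := h.eq_of_mem e c a hce.symm hae.symm hac.symm
  have hP := (h.path a b hab).trans (h.path b c hbc) fun v hv =>
    i₁ v (h.symm a b ▸ hv.1) hv.2
  have hQ := (h.path c e hce).trans (h.path e a hae.symm) fun v hv =>
    i₂ v (h.symm c e ▸ hv.1) hv.2
  obtain ⟨q, hq, hs⟩ := hP.exists_isCycle hQ (by
    rintro v ⟨hv | hv, hv' | hv'⟩
    · exact absurd hv' (h.notMem a b c e hab hac hae hbc hbe hce v hv)
    · exact Or.inl (h.eq_of_mem a b e hab hae hbe v hv (h.symm e a ▸ hv'))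
    · exact Or.inr (h.eq_of_mem c b e hbc.symm hce hbe v (h.symm b c ▸ hv) hv')
    · exact absurd hv' (h.notMem b c e a hbc hbe hab.symm hce hac.symm hae.symm v hv))
    (Or.inr (h.left_mem hbc)) (h.injective.ne hab.symm) (h.injective.ne hbc)
  refine nonempty_threeWheelSub hq ?_ ((hs _).2 hx) ((hs _).2 hy) ((hs _).2 hz)
    hxy hxz hyz hdx hdy hdz
  rw [hs]
  rintro ((hv | hv) | hv | hv)
  exacts [hd a b hab hv, hd b c hbc hv, hd c e hce hv, hd e a hae.symm hv]

end IsK4Paths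

/-- If a vertex `d` outside a minimal model has a neighbor in the interior of each of the three
subdivided edges at a branch vertex, then one of these edges can be rerouted through `d`; by
minimality, the branch vertex `f a` released in this way is the center of a 3-wheel. -/
lemma IsMinK4Model.wheel_of_claw [Finite V] {A : Fin 4 → Set V} (hA : IsMinK4Model G A)
    (h : IsK4Paths G f E) (hEA : ∀ i j, i ≠ j → E i j ⊆ ⋃ k, A k) {w a b c : Fin 4}
    (hwa : w ≠ a) (hwb : w ≠ b) (hwc : w ≠ c) (hab : a ≠ b) (hac : a ≠ c) (hbc : b ≠ c)
    {d x y z : V} (hd : d ∉ ⋃ k, A k) (hx : x ∈ E w a) (hy : y ∈ E w b) (hz : z ∈ E w c)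
    (hxf : ∀ k, x ≠ f k) (hyf : ∀ k, y ≠ f k) (hzf : ∀ k, z ≠ f k)
    (hdx : G.Adj d x) (hdy : G.Adj d y) (hdz : G.Adj d z) : Nonempty (ThreeWheelSub G) := by
  have hdE : ∀ i j, i ≠ j → d ∉ E i j := fun i j hij hdE => hd (hEA i j hij hdE)
  obtain ⟨P₁, P₂, hP₁, hP₂, hP, hPI⟩ := (h.path w a hwa).split hx
  obtain ⟨Q₁, Q₂, hQ₁, hQ₂, hQ, hQI⟩ := (h.path w b hwb).split hy
  obtain ⟨R₁, R₂, hR₁, hR₂, hR, hRI⟩ := (h.path w c hwc).split hz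
  have hP₁s : P₁ ⊆ E w a := hP ▸ Set.subset_union_left
  have hP₂s : P₂ ⊆ E w a := hP ▸ Set.subset_union_right
  have hQ₁s : Q₁ ⊆ E w b := hQ ▸ Set.subset_union_left
  have hQ₂s : Q₂ ⊆ E w b := hQ ▸ Set.subset_union_right
  have hR₁s : R₁ ⊆ E w c := hR ▸ Set.subset_union_left
  have hR₂s : R₂ ⊆ E w c := hR ▸ Set.subset_union_right
  replace hPI : ∀ v ∈ P₁, v ∈ P₂ → v = x := fun v h₁ h₂ => hPI ⟨h₁, h₂⟩
  replace hQI : ∀ v ∈ Q₁, v ∈ Q₂ → v = y := fun v h₁ h₂ => hQI ⟨h₁, h₂⟩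
  replace hRI : ∀ v ∈ R₁, v ∈ R₂ → v = z := fun v h₁ h₂ => hRI ⟨h₁, h₂⟩
  clear hP hQ hR
  have hwP : f w ∉ P₂ := fun hm => hxf w (hPI _ hP₁.left_mem hm).symm
  have hwQ : f w ∉ Q₂ := fun hm => hyf w (hQI _ hQ₁.left_mem hm).symm
  have hwR : f w ∉ R₂ := fun hm => hzf w (hRI _ hR₁.left_mem hm).symm
  have haP : f a ∉ P₁ := fun hm => hxf a (hPI _ hm hP₂.right_mem).symm
  have hcR : f c ∉ R₁ := fun hm => hzf c (hRI _ hm hR₂.right_mem).symm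
  have wab := h.eq_of_mem w a b hwa hwb hab
  have wac := h.eq_of_mem w a c hwa hwc hac
  have wbc := h.eq_of_mem w b c hwb hwc hbc
  have awb := h.eq_of_mem a w b hwa.symm hab hwb
  have awc := h.eq_of_mem a w c hwa.symm hac hwc
  have bwa := h.eq_of_mem b w a hwb.symm hab.symm hwa
  have bwc := h.eq_of_mem b w c hwb.symm hbc hwc
  have bac := h.eq_of_mem b a c hab.symm hbc hac
  have cwa := h.eq_of_mem c w a hwc.symm hac.symm hwa
  have cwb := h.eq_of_mem c w b hwc.symm hbc.symm hwb
  have cab := h.eq_of_mem c a b hac.symm hbc.symm hab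
  rw [h.symm a w] at awb awc
  rw [h.symm b w] at bwa bwc
  rw [h.symm b a] at bwa bac
  rw [h.symm c w] at cwa cwb
  rw [h.symm c a] at cwa cab
  rw [h.symm c b] at cwb cab
  have nwa := h.notMem w a b c hwa hwb hwc hab hac hbc
  have nwb := h.notMem w b a c hwb hwa hwc hab.symm hbc hac
  have nwc := h.notMem w c a b hwc hwa hwb hac.symm hbc.symm hab
  have fwb := h.branch_notMem hwb hwa hab.symm
  have fwc := h.branch_notMem hwc hwa hac.symm
  have fbc := h.branch_notMem hbc hab.symm hac.symm
  have hsmall : ∀ t ∈ P₂ ∪ E a b ∪ E a c, t = x ∨ t = f a ∨ t = f b ∨ t = f c := by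
    intro t ht
    by_contra! htne
    obtain ⟨htx, hta, htb, htc⟩ := htne
    have hQd := hQ₁.sdiff_right (hyf w).symm
    have hRd := hR₁.sdiff_right (hzf w).symm
    have hEd := (h.path c b hbc.symm).sdiff_right (h.injective.ne hbc.symm)
    rw [h.symm c b] at hEd
    let B : Fin 4 → Set V :=
      ![P₁ ∪ Q₁ \ {y} ∪ R₁ \ {z}, {d}, Q₂, R₂ ∪ E b c \ {f b}]
    have hB : IsK4Model G B := by
      apply IsK4Model.of_lt
      · intro i
        fin_cases i
        · refine induce_union_connected (induce_union_connected hP₁.connected.preconnected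
            hQd.1.preconnected ⟨f w, hP₁.left_mem, hQ₁.left_mem, (hyf w).symm⟩).preconnected
            hRd.1.preconnected ⟨f w, Or.inl hP₁.left_mem, hR₁.left_mem, (hzf w).symm⟩
        · exact connected_singleton d
        · exact hQ₂.connected
        · exact induce_union_connected hR₂.connected.preconnected hEd.1.preconnected
            ⟨f c, hR₂.right_mem, h.right_mem hbc, h.injective.ne hbc.symm⟩
      · intro i j hij
        rw [Set.disjoint_left]
        have := hdE w a hwa
        have := hdE w b hwb
        have := hdE w c hwc
        have := hdE b c hbc
        fin_cases i <;> fin_cases j <;> first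
          | exact absurd hij (by decide)
          | (intro v hv hv'; simp [B] at hv hv'; clear hQd hRd hEd ht; grind)
      · obtain ⟨-, u, hu, huy⟩ := hQd
        obtain ⟨-, u', hu', huz⟩ := hRd
        obtain ⟨-, v, hv, hvb⟩ := hEd
        have t₀₁ : Touches G (B 0) (B 1) :=
          ⟨x, Or.inl (Or.inl hP₁.right_mem), d, rfl, hdx.symm⟩
        have t₀₂ : Touches G (B 0) (B 2) := ⟨u, Or.inl (Or.inr hu), y, hQ₂.left_mem, huy⟩
        have t₀₃ : Touches G (B 0) (B 3) := ⟨u', Or.inr hu', z, Or.inl hR₂.left_mem, huz⟩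
        have t₁₂ : Touches G (B 1) (B 2) := ⟨d, rfl, y, hQ₂.left_mem, hdy⟩
        have t₁₃ : Touches G (B 1) (B 3) := ⟨d, rfl, z, Or.inl hR₂.left_mem, hdz⟩
        have t₂₃ : Touches G (B 2) (B 3) := ⟨f b, hQ₂.right_mem, v, Or.inr hv, hvb.symm⟩
        intro i j hij
        fin_cases i <;> fin_cases j <;> first
          | exact absurd hij (by decide)
          | assumption
    have hBs : (⋃ k, B k) ⊆ insert d ((⋃ k, A k) \ {f a, t}) := by
      have := hEA w a hwa
      have := hEA w b hwb
      have := hEA w c hwc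
      have := hEA b c hbc
      refine Set.iUnion_subset fun i v hv => ?_
      clear hQd hRd hEd hB
      fin_cases i <;> simp [B] at hv <;> grind
    have htA : t ∈ ⋃ k, A k := by
      rcases ht with (ht | ht) | ht
      exacts [hEA w a hwa (hP₂s ht), hEA a b hab ht, hEA a c hac ht]
    have hpair : {f a, t} ⊆ ⋃ k, A k := Set.insert_subset (hEA a b hab (h.left_mem hab))
      (Set.singleton_subset_iff.2 htA)
    have h₁ := (hA.le_ncard B hB).trans ((Set.ncard_le_ncard hBs).trans (Set.ncard_insert_le _ _))
    have h₂ := Set.ncard_sdiff_add_ncard_of_subset hpair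
    rw [Set.ncard_pair hta.symm] at h₂
    omega
  have hadx : G.Adj (f a) x := by
    refine (hP₂.adj_of_subset_pair (hxf a) fun t ht => ?_).symm
    have := hsmall t (Or.inl (Or.inl ht))
    have := h.branch_notMem hwa hwb hab
    have := h.branch_notMem hwa hwc hac
    grind
  have hadb : G.Adj (f a) (f b) := by
    refine (h.path a b hab).adj_of_subset_pair (h.injective.ne hab) fun t ht => ?_
    have := hsmall t (Or.inl (Or.inr ht))
    have := h.branch_notMem hab hac hbc
    grind
  have hadc : G.Adj (f a) (f c) := by
    refine (h.path a c hac).adj_of_subset_pair (h.injective.ne hac) fun t ht => ?_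
    have := hsmall t (Or.inr ht)
    have := h.branch_notMem hac hab hbc.symm
    grind
  have hC := ((hP₁.symm.trans (h.path w b hwb) ?_).trans (h.path b c hbc) ?_).trans hR₂.symm ?_
  · have hxz : x ≠ z := by grind
    obtain ⟨q, hq, hs⟩ := hC.exists_isCycle
      ((PathSet.pair hdz.symm).trans (.pair hdx) (by grind))
      (by have := hdE w a hwa
          have := hdE w b hwb
          have := hdE w c hwc
          have := hdE b c hbc
          rintro v ⟨hv, (rfl | rfl) | rfl | rfl⟩ <;> grind)
      (Or.inl (Or.inl (Or.inl hP₁.left_mem))) (hxf w).symm (hzf w).symm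
    refine nonempty_threeWheelSub hq ?_ ((hs _).2 ?_) ((hs _).2 ?_) ((hs _).2 ?_) (hxf b) (hxf c)
      (h.injective.ne hbc) hadx hadb hadc
    · rw [hs]
      have := hdE a b hab
      have := h.left_mem hab
      grind
    · exact Or.inl (Or.inl (Or.inl (Or.inl hP₁.right_mem)))
    · exact Or.inl (Or.inl (Or.inr (h.left_mem hbc)))
    · exact Or.inl (Or.inl (Or.inr (h.right_mem hbc)))
  all_goals rintro v ⟨hv, hv'⟩; grind

/-- A vertex outside a minimal model with three neighbors in the model yields a 3-wheel. -/
lemma IsMinK4Model.wheel_of_three_neighbors [Finite V] {A : Fin 4 → Set V}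
    (hA : IsMinK4Model G A) {d x y z : V} (hd : d ∉ ⋃ k, A k) (hx : x ∈ ⋃ k, A k)
    (hy : y ∈ ⋃ k, A k) (hz : z ∈ ⋃ k, A k) (hxy : x ≠ y) (hxz : x ≠ z) (hyz : y ≠ z)
    (hdx : G.Adj d x) (hdy : G.Adj d y) (hdz : G.Adj d z) : Nonempty (ThreeWheelSub G) := by
  obtain ⟨f, E, h, hEA, hcov⟩ := hA.exists_isK4Paths
  have hdE : ∀ i j, i ≠ j → d ∉ E i j := fun i j hij hdE => hd (hEA i j hij hdE)
  by_contra hno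
  have key : ∀ a b c e : Fin 4, a ≠ b → a ≠ c → a ≠ e → b ≠ c → b ≠ e → c ≠ e →
      ∃ u, G.Adj d u ∧ (∀ k, u ≠ f k) ∧ (u ∈ E a c ∨ u ∈ E b e) ∧
        u ∉ E a b ∧ u ∉ E b c ∧ u ∉ E c e ∧ u ∉ E e a := by
    intro a b c e hab hac hae hbc hbe hce
    obtain ⟨u, hdu, hu, hH⟩ : ∃ u, G.Adj d u ∧ u ∈ ⋃ k, A k ∧
        u ∉ E a b ∪ E b c ∪ (E c e ∪ E e a) := by
      by_contra! hall
      exact hno (h.wheel_of_square hab hac hae hbc hbe hce hdE (hall x hdx hx) (hall y hdy hy)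
        (hall z hdz hz) hxy hxz hyz hdx hdy hdz)
    simp only [Set.mem_union, not_or] at hH
    obtain ⟨⟨hab', hbc'⟩, hce', hea'⟩ := hH
    have hcase : ∀ k, k = a ∨ k = b ∨ k = c ∨ k = e := by lia
    refine ⟨u, hdu, ?_, ?_, hab', hbc', hce', hea'⟩
    · rintro k rfl
      rcases hcase k with rfl | rfl | rfl | rfl
      exacts [hab' (h.left_mem hab), hbc' (h.left_mem hbc), hce' (h.left_mem hce),
        hea' (h.left_mem hae.symm)]
    · obtain ⟨i, j, hij, hu⟩ := hcov u hu
      have hba := h.symm a b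
      have hcb := h.symm b c
      have hec := h.symm c e
      have hae := h.symm e a
      have hca := h.symm a c
      have heb := h.symm b e
      rcases hcase i with rfl | rfl | rfl | rfl <;>
        rcases hcase j with rfl | rfl | rfl | rfl <;> grind
  obtain ⟨u, hdu, huf, hu, -⟩ := key 0 1 2 3 (by decide) (by decide) (by decide) (by decide)
    (by decide) (by decide)
  obtain ⟨v, hdv, hvf, hv, hvE⟩ := key 0 2 1 3 (by decide) (by decide) (by decide) (by decide)
    (by decide) (by decide)
  obtain ⟨t, hdt, htf, ht, htE⟩ := key 0 1 3 2 (by decide) (by decide) (by decide) (by decide)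
    (by decide) (by decide)
  have huv : u ≠ v := by
    rintro rfl
    tauto
  have hut : u ≠ t := by
    rintro rfl
    rw [h.symm 2 0] at htE
    tauto
  have hvt : v ≠ t := by
    rintro rfl
    rw [h.symm 3 2] at htE
    tauto
  have triangle : ∀ a b c : Fin 4, a ≠ b → a ≠ c → b ≠ c → ∀ x ∈ E a b, ∀ y ∈ E b c,
      ∀ z ∈ E a c, x ≠ y → x ≠ z → y ≠ z → G.Adj d x → G.Adj d y → G.Adj d z → False := by
    intro a b c hab hac hbc x hx y hy z hz hxy hxz hyz hdx hdy hdz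
    exact hno (h.wheel_of_triangle hab hac hbc hdE (Or.inl (Or.inl hx)) (Or.inl (Or.inr hy))
      (Or.inr hz) hxy hxz hyz hdx hdy hdz)
  have claw : ∀ w a b c : Fin 4, w ≠ a → w ≠ b → w ≠ c → a ≠ b → a ≠ c → b ≠ c →
      ∀ x ∈ E w a, ∀ y ∈ E w b, ∀ z ∈ E w c, (∀ k, x ≠ f k) → (∀ k, y ≠ f k) → (∀ k, z ≠ f k) →
      G.Adj d x → G.Adj d y → G.Adj d z → False :=
    fun w a b c hwa hwb hwc hab hac hbc x hx y hy z hz hxf hyf hzf hdx hdy hdz =>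
      hno (hA.wheel_of_claw h hEA hwa hwb hwc hab hac hbc hd hx hy hz hxf hyf hzf hdx hdy hdz)
  rcases hu with hu | hu <;> rcases hv with hv | hv <;> rcases ht with ht | ht
  · exact claw 0 2 1 3 (by decide) (by decide) (by decide) (by decide) (by decide) (by decide)
      u hu v hv t ht huf hvf htf hdu hdv hdt
  · exact triangle 0 1 2 (by decide) (by decide) (by decide)
      v hv t ht u hu hvt huv.symm hut.symm hdv hdt hdu
  · exact triangle 0 2 3 (by decide) (by decide) (by decide)
      u hu v hv t ht huv hut hvt hdu hdv hdt
  · rw [h.symm] at hu ht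
    exact claw 2 0 3 1 (by decide) (by decide) (by decide) (by decide) (by decide) (by decide)
      u hu v hv t ht huf hvf htf hdu hdv hdt
  · exact triangle 0 1 3 (by decide) (by decide) (by decide)
      v hv u hu t ht huv.symm hvt hut hdv hdu hdt
  · rw [h.symm] at hv
    exact claw 1 3 0 2 (by decide) (by decide) (by decide) (by decide) (by decide) (by decide)
      u hu v hv t ht huf hvf htf hdu hdv hdt
  · rw [h.symm] at hu hv ht
    exact claw 3 1 2 0 (by decide) (by decide) (by decide) (by decide) (by decide) (by decide)
      u hu v hv t ht huf hvf htf hdu hdv hdt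
  · exact triangle 1 2 3 (by decide) (by decide) (by decide)
      t ht v hv u hu hvt.symm hut.symm huv.symm hdt hdv hdu

end Wheel

/-- Every 2-connected `K̂₄`-induced minor-free graph containing a proper
`K₄`-subdivision has a 3-wheel as a subgraph. -/
theorem exists_three_wheel {α : Type*} [Fintype α] (G : SimpleGraph α)
    (h2 : TwoConnected G) (hfree : ¬ IsInducedMinor hatK4 G)
    (hprop : HasProperK4Subdivision G) :
    Nonempty (ThreeWheelSub G) := by
  obtain ⟨A₀, v, hA₀, hv⟩ := hprop.exists_isK4Model
  obtain ⟨A, hA, hle⟩ := hA₀.exists_isMinK4Model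
  obtain ⟨u, hu⟩ : ∃ u, u ∉ ⋃ i, A i := by
    by_contra! hall
    rw [Set.eq_univ_of_forall hall] at hle
    have hlt : (⋃ i, A₀ i).ncard < (Set.univ : Set α).ncard := Set.ncard_lt_ncard
      (Set.ssubset_univ_iff.2 fun h => hv (h ▸ Set.mem_univ v))
    omega
  have hnt : (⋃ i, A i).Nontrivial := by
    obtain ⟨x, hx, y, hy, hxy⟩ := hA.touches 0 1 (by decide)
    exact ⟨x, Set.mem_iUnion_of_mem 0 hx, y, Set.mem_iUnion_of_mem 1 hy, hxy.ne⟩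
  obtain ⟨D, hD, hdisj, p, hp, q, hq, hpq, hDp, hDq, honly⟩ |
    ⟨d, hd, x, hx, y, hy, z, hz, hxy, hxz, hyz, hdx, hdy, hdz⟩ := h2.exists_attachment hnt hu
  · obtain ⟨B, hB, hBA, i, j, hij, hpi, hqj⟩ := hA.exists_separating hp hq hpq
    exact absurd (hB.isInducedMinor_hatK4 hD (hBA ▸ hdisj) hij hpi hqj hDp hDq (hBA ▸ honly)) hfree
  · exact hA.wheel_of_three_neighbors hd hx hy hz hxy hxz hyz hdx hdy hdz

end IMWQO
end

section
/- Let G be a 2-connected finite simple graph that does not contain K̂₄ as an induced minor and that contains a proper K₄-subdivision. Let W be a 3-wheel subgraph of G with the minimum number of vertices, let C be the cycle of W, and let R be the subgraph of G induced by V(G) \ V(C). Then every two non-adjacent vertices of R have the same neighborhood in C. -/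
open SimpleGraph

namespace IMWQO

section ForbiddenMinor

variable {α : Type*} {G : SimpleGraph α}

lemma connected_induce_singleton (v : α) : (G.induce {v}).Connected := by
  rw [connected_iff_exists_forall_reachable]
  refine ⟨⟨v, rfl⟩, ?_⟩
  rintro ⟨w, rfl⟩
  exact Reachable.refl _

lemma connected_induce_insert {s : Set α} {v w : α} (hs : (G.induce s).Connected)
    (hv : v ∈ s) (hvw : G.Adj v w) : (G.induce (s ∪ {w})).Connected :=
  connected_induce_union hs.preconnected (connected_induce_singleton w).preconnected hv rfl hvw

/-- Every vertex of `U` lies in a connected subset of `U` that is closed under adjacency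
inside `U`. -/
lemma exists_component_within (U : Set α) {v : α} (hv : v ∈ U) :
    ∃ D ⊆ U, v ∈ D ∧ (G.induce D).Connected ∧
      ∀ d ∈ D, ∀ w ∈ U, G.Adj d w → w ∈ D := by
  refine ⟨⋃₀ {s | v ∈ s ∧ s ⊆ U ∧ (G.induce s).Connected}, ?_, ?_, ?_, ?_⟩
  · exact Set.sUnion_subset fun s hs => hs.2.1
  · exact ⟨{v}, ⟨rfl, by simpa using hv, connected_induce_singleton v⟩, rfl⟩
  · refine induce_sUnion_connected_of_pairwise_not_disjoint
      ⟨{v}, rfl, by simpa using hv, connected_induce_singleton v⟩ ?_ fun hs => hs.2.2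
    exact fun hs ht => ⟨v, hs.1, ht.1⟩
  · rintro d ⟨s, ⟨hvs, hsU, hs⟩, hds⟩ w hw hdw
    refine ⟨s ∪ {w}, ⟨Or.inl hvs, ?_, connected_induce_insert hs hds hdw⟩, Or.inr rfl⟩
    exact Set.union_subset hsU (by simpa using hw)

/-- A connected vertex-deleted subgraph has an edge leaving any proper nonempty vertex set. -/
lemma exists_adj_leaving {t : α} (ht : (G.induce {u | u ≠ t}).Connected) {D : Set α} {v s : α}
    (hv : v ∈ D) (hvt : v ≠ t) (hs : s ∉ D) (hst : s ≠ t) :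
    ∃ d ∈ D, ∃ w, w ∉ D ∧ w ≠ t ∧ G.Adj d w := by
  obtain ⟨p⟩ := ht.preconnected ⟨v, hvt⟩ ⟨s, hst⟩
  obtain ⟨d, -, hd, hd'⟩ := p.exists_boundary_dart (Subtype.val ⁻¹' D) hv hs
  exact ⟨d.fst, hd, d.snd, hd', d.snd.2, d.adj⟩

/-- Four pairwise disjoint, pairwise adjacent, connected vertex sets. -/
structure IsK4Model_s10 (G : SimpleGraph α) (B : Fin 4 → Set α) : Prop where
  connected : ∀ a, (G.induce (B a)).Connected
  disjoint : ∀ a b, a ≠ b → Disjoint (B a) (B b)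
  adj : ∀ a b, a ≠ b → ∃ x ∈ B a, ∃ y ∈ B b, G.Adj x y

lemma IsK4Model_s10.comp {B : Fin 4 → Set α} (hB : IsK4Model_s10 G B) (σ : Equiv.Perm (Fin 4)) :
    IsK4Model_s10 G (B ∘ σ) where
  connected _ := hB.connected _
  disjoint _ _ hab := hB.disjoint _ _ (σ.injective.ne hab)
  adj _ _ hab := hB.adj _ _ (σ.injective.ne hab)

lemma exists_perm_fin_four (a b : Fin 4) (hab : a ≠ b) :
    ∃ σ : Equiv.Perm (Fin 4), σ 0 = a ∧ σ 1 = b := by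
  refine ⟨(Equiv.swap 0 a).trans (Equiv.swap (Equiv.swap 0 a 1) b) , ?_, ?_⟩ <;>
  · revert a b
    decide

/-- A `K₄` model and a further connected set touching exactly its first two branch sets give
`K̂₄` as an induced minor. -/
lemma IsK4Model_s10.isInducedMinor_hatK4 {B : Fin 4 → Set α} (hB : IsK4Model_s10 G B) {D : Set α}
    (hD : (G.induce D).Connected) (hdisj : ∀ a, Disjoint D (B a))
    (h : ∀ a, (∃ x ∈ D, ∃ y ∈ B a, G.Adj x y) ↔ a = 0 ∨ a = 1) :
    IsInducedMinor hatK4 G := by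
  have hcast : ∀ a b : Fin 4, a ≠ b → hatK4.Adj a.castSucc b.castSucc := by
    intro a b hab
    simp only [hatK4, fromRel_adj]
    refine ⟨fun h => hab (Fin.castSucc_injective _ h), Or.inl (Or.inl ?_)⟩
    simp
  have hlast : ∀ a : Fin 4, hatK4.Adj (Fin.last 4) a.castSucc ↔ a = 0 ∨ a = 1 := by
    intro a
    simp only [hatK4, fromRel_adj]
    revert a
    decide
  obtain ⟨μ, hμD, hμB⟩ : ∃ μ : Fin 5 → Set α, μ (Fin.last 4) = D ∧ ∀ a : Fin 4,
      μ a.castSucc = B a :=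
    ⟨Fin.snoc (α := fun _ => Set α) B D, Fin.snoc_last .., fun a => Fin.snoc_castSucc ..⟩
  have hconn : ∀ a, (G.induce (μ a)).Connected := by
    intro a
    induction a using Fin.lastCases with
    | last => rwa [hμD]
    | cast a => rw [hμB]; exact hB.connected a
  refine ⟨μ, fun a => ?_, ?_, hconn, ?_⟩
  · obtain ⟨x, hx⟩ := (hconn a).nonempty
    exact ⟨x, hx⟩
  · intro a b hab
    induction a using Fin.lastCases with
    | last =>
      induction b using Fin.lastCases with
      | last => exact absurd rfl hab
      | cast b => rw [hμD, hμB]; exact hdisj b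
    | cast a =>
      induction b using Fin.lastCases with
      | last => rw [hμD, hμB]; exact (hdisj a).symm
      | cast b => rw [hμB, hμB]; exact hB.disjoint a b fun h => hab (by rw [h])
  · intro a b hab
    induction a using Fin.lastCases with
    | last =>
      induction b using Fin.lastCases with
      | last => exact absurd rfl hab
      | cast b => rw [hμD, hμB, hlast]; exact h b
    | cast a =>
      induction b using Fin.lastCases with
      | last =>
        rw [hatK4.adj_comm, hlast, ← h a, hμD, hμB]
        constructor <;>
        · rintro ⟨x, hx, y, hy, hxy⟩
          exact ⟨y, hy, x, hx, hxy.symm⟩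
      | cast b =>
        have hab' : a ≠ b := fun h => hab (by rw [h])
        rw [hμB, hμB]
        exact iff_of_true (hB.adj a b hab') (hcast a b hab')

lemma IsK4Model_s10.isInducedMinor_hatK4_of_ne {B : Fin 4 → Set α} (hB : IsK4Model_s10 G B)
    {D : Set α} (hD : (G.induce D).Connected) (hdisj : ∀ a, Disjoint D (B a)) {p q : Fin 4}
    (hpq : p ≠ q) (h : ∀ a, (∃ x ∈ D, ∃ y ∈ B a, G.Adj x y) ↔ a = p ∨ a = q) :
    IsInducedMinor hatK4 G := by
  obtain ⟨σ, rfl, rfl⟩ := exists_perm_fin_four p q hpq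
  refine (hB.comp σ).isInducedMinor_hatK4 hD (fun a => hdisj _) fun a => ?_
  simpa using h (σ a)

/-- The vertex set `S` is the union of a `K₄` model separating any two prescribed vertices. -/
def SeparableK4 (G : SimpleGraph α) (S : Set α) : Prop :=
  ∀ s₁ ∈ S, ∀ s₂ ∈ S, s₁ ≠ s₂ →
    ∃ B : Fin 4 → Set α, IsK4Model_s10 G B ∧ (⋃ a, B a) = S ∧ s₁ ∈ B 0 ∧ s₂ ∈ B 1

lemma SeparableK4.isInducedMinor_hatK4 {S : Set α} (hS : SeparableK4 G S) {D : Set α}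
    (hD : (G.induce D).Connected) (hDS : Disjoint D S) {s₁ s₂ t₁ t₂ : α}
    (hs₁ : s₁ ∈ S) (hs₂ : s₂ ∈ S) (hs : s₁ ≠ s₂) (ht : t₁ ≠ t₂)
    (ht₁ : t₁ = s₁ ∨ t₁ ∉ S ∧ G.Adj s₁ t₁) (ht₂ : t₂ = s₂ ∨ t₂ ∉ S ∧ G.Adj s₂ t₂)
    (htD₁ : t₁ ∉ D) (htD₂ : t₂ ∉ D)
    (hadj₁ : ∃ d ∈ D, G.Adj d t₁) (hadj₂ : ∃ d ∈ D, G.Adj d t₂)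
    (honly : ∀ d ∈ D, ∀ s ∈ S, G.Adj d s → s = t₁ ∨ s = t₂) :
    IsInducedMinor hatK4 G := by
  obtain ⟨B, hB, hBS, hsB₁, hsB₂⟩ := hS s₁ hs₁ s₂ hs₂ hs
  have hsub : ∀ a, B a ⊆ S := fun a => hBS ▸ Set.subset_iUnion B a
  have hnot : ∀ a b, a ≠ b → ∀ x, x ∈ B a → x ∉ B b := fun a b hab x hx hx' =>
    Set.disjoint_left.mp (hB.disjoint a b hab) hx hx'
  have htB₁ : ∀ a, a ≠ 0 → t₁ ∉ B a := by
    rintro a ha hta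
    rcases ht₁ with rfl | ⟨h, -⟩
    · exact hnot _ _ ha _ hta hsB₁
    · exact h (hsub a hta)
  have htB₂ : ∀ a, a ≠ 1 → t₂ ∉ B a := by
    rintro a ha hta
    rcases ht₂ with rfl | ⟨h, -⟩
    · exact hnot _ _ ha _ hta hsB₂
    · exact h (hsub a hta)
  have hc₁ : (G.induce (B 0 ∪ {t₁})).Connected := by
    rcases ht₁ with rfl | ⟨-, h⟩
    · rw [Set.union_eq_left.mpr (by simpa using hsB₁)]
      exact hB.connected 0
    · exact connected_induce_insert (hB.connected 0) hsB₁ h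
  have hc₂ : (G.induce (B 1 ∪ {t₂})).Connected := by
    rcases ht₂ with rfl | ⟨-, h⟩
    · rw [Set.union_eq_left.mpr (by simpa using hsB₂)]
      exact hB.connected 1
    · exact connected_induce_insert (hB.connected 1) hsB₂ h
  let T : Fin 4 → Set α := ![{t₁}, {t₂}, ∅, ∅]
  have hTmem : ∀ a x, x ∈ T a ↔ a = 0 ∧ x = t₁ ∨ a = 1 ∧ x = t₂ := by
    intro a x
    fin_cases a <;> simp [T]
  refine IsK4Model_s10.isInducedMinor_hatK4 (B := fun a => B a ∪ T a) ⟨?_, ?_, ?_⟩ hD ?_ ?_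
  · intro a
    fin_cases a
    · exact hc₁
    · exact hc₂
    · exact (Set.union_empty (B 2)).symm ▸ hB.connected 2
    · exact (Set.union_empty (B 3)).symm ▸ hB.connected 3
  · intro a b hab
    rw [Set.disjoint_left]
    rintro x (hx | hx) (hx' | hx')
    · exact hnot a b hab x hx hx'
    · rcases (hTmem _ _).mp hx' with ⟨rfl, rfl⟩ | ⟨rfl, rfl⟩
      · exact htB₁ a hab hx
      · exact htB₂ a hab hx
    · rcases (hTmem _ _).mp hx with ⟨rfl, rfl⟩ | ⟨rfl, rfl⟩
      · exact htB₁ b hab.symm hx'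
      · exact htB₂ b hab.symm hx'
    · rw [hTmem] at hx hx'
      grind
  · intro a b hab
    obtain ⟨x, hx, y, hy, hxy⟩ := hB.adj a b hab
    exact ⟨x, Or.inl hx, y, Or.inl hy, hxy⟩
  · intro a
    rw [Set.disjoint_right]
    rintro x (hx | hx) hxD
    · exact Set.disjoint_left.mp hDS hxD (hsub a hx)
    · rcases (hTmem _ _).mp hx with ⟨rfl, rfl⟩ | ⟨rfl, rfl⟩
      · exact htD₁ hxD
      · exact htD₂ hxD
  · intro a
    constructor
    · rintro ⟨d, hd, y, hy | hy, hdy⟩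
      · rcases honly d hd y (hsub a hy) hdy with rfl | rfl
        · left
          by_contra ha
          exact htB₁ a ha hy
        · right
          by_contra ha
          exact htB₂ a ha hy
      · rw [hTmem] at hy
        tauto
    · rintro (rfl | rfl)
      · obtain ⟨d, hd, hdt⟩ := hadj₁
        exact ⟨d, hd, t₁, Or.inr rfl, hdt⟩
      · obtain ⟨d, hd, hdt⟩ := hadj₂
        exact ⟨d, hd, t₂, Or.inr rfl, hdt⟩

/-- A vertex outside a separable `K₄` set cannot have a unique neighbor in the set. -/
lemma SeparableK4.not_unique_neighbor (hfree : ¬ IsInducedMinor hatK4 G)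
    (h2 : ∀ v, (G.induce {u | u ≠ v}).Connected) {S : Set α} (hS : SeparableK4 G S)
    (hnt : S.Nontrivial) {v s : α} (hv : v ∉ S) (hs : s ∈ S) (hvs : G.Adj v s) :
    ∃ w ∈ S, w ≠ s ∧ G.Adj v w := by
  by_contra! hno
  let U : Set α := {w | w ∉ S ∧ ∀ z ∈ S, G.Adj w z → z = s}
  have hvU : v ∈ U := ⟨hv, fun z hz hvz => by
    by_contra hzs
    exact hno z hz hzs hvz⟩
  obtain ⟨D, hDU, hvD, hD, hclosed⟩ := exists_component_within (G := G) U hvU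
  obtain ⟨s', hs', hss'⟩ := hnt.exists_ne s
  obtain ⟨d, hd, t, htD, hts, hdt⟩ := exists_adj_leaving (h2 s) hvD
    (fun h => hv (h ▸ hs)) (fun h => (hDU h).1 hs') hss'
  have htS : t ∉ S := fun h => hts ((hDU hd).2 t h hdt)
  have htU : t ∉ U := fun h => htD (hclosed d hd t h hdt)
  obtain ⟨z, hz, htz, hzs⟩ : ∃ z ∈ S, G.Adj t z ∧ z ≠ s := by
    by_contra! h
    exact htU ⟨htS, h⟩
  refine hfree (hS.isInducedMinor_hatK4 hD ?_ hs hz hzs.symm hts.symm (Or.inl rfl)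
    (Or.inr ⟨htS, htz.symm⟩) (fun h => (hDU h).1 hs) htD ⟨v, hvD, hvs⟩ ⟨d, hd, hdt⟩
    fun d hd z hz hdz => Or.inl ((hDU hd).2 z hz hdz))
  exact Set.disjoint_left.mpr fun d hd => (hDU hd).1

/-- A vertex outside a separable `K₄` set has a neighbor in the set. -/
lemma SeparableK4.exists_neighbor (hfree : ¬ IsInducedMinor hatK4 G)
    (h2 : ∀ v, (G.induce {u | u ≠ v}).Connected) {S : Set α} (hS : SeparableK4 G S)
    (hnt : S.Nontrivial) {v : α} (hv : v ∉ S) : ∃ w ∈ S, G.Adj v w := by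
  by_contra! hno
  let U : Set α := {w | w ∉ S ∧ ∀ z ∈ S, ¬ G.Adj w z}
  obtain ⟨D, hDU, hvD, hD, hclosed⟩ := exists_component_within (G := G) U (v := v) ⟨hv, hno⟩
  have hleave : ∀ {d t}, d ∈ D → t ∉ D → G.Adj d t → t ∉ S ∧ ∃ z ∈ S, G.Adj t z := by
    intro d t hd ht hdt
    have htS : t ∉ S := fun h => (hDU hd).2 t h hdt
    refine ⟨htS, ?_⟩
    by_contra! h
    exact ht (hclosed d hd t ⟨htS, h⟩ hdt)
  obtain ⟨s, hs, s', hs', hss'⟩ := hnt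
  have hsD : ∀ {z}, z ∈ S → z ∉ D := fun hz h => (hDU h).1 hz
  obtain ⟨d₁, hd₁, t₁, htD₁, -, hdt₁⟩ := exists_adj_leaving (h2 s) hvD
    (fun h => hv (h ▸ hs)) (hsD hs') hss'.symm
  obtain ⟨htS₁, z₁, hz₁, htz₁⟩ := hleave hd₁ htD₁ hdt₁
  obtain ⟨d₂, hd₂, t₂, htD₂, htt, hdt₂⟩ := exists_adj_leaving (h2 t₁) hvD
    (fun h => htD₁ (h ▸ hvD)) (hsD hs) (fun h => htS₁ (h ▸ hs))
  obtain ⟨htS₂, z, hz, htz⟩ := hleave hd₂ htD₂ hdt₂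
  obtain ⟨z₂, hz₂, hzz, htz₂⟩ : ∃ z₂ ∈ S, z₂ ≠ z₁ ∧ G.Adj t₂ z₂ := by
    by_cases h : z = z₁
    · subst h
      exact hS.not_unique_neighbor hfree h2 ⟨s, hs, s', hs', hss'⟩ htS₂ hz htz
    · exact ⟨z, hz, h, htz⟩
  refine hfree (hS.isInducedMinor_hatK4 hD ?_ hz₁ hz₂ hzz.symm htt.symm
    (Or.inr ⟨htS₁, htz₁.symm⟩) (Or.inr ⟨htS₂, htz₂.symm⟩) htD₁ htD₂ ⟨d₁, hd₁, hdt₁⟩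
    ⟨d₂, hd₂, hdt₂⟩ fun d hd z hz hdz => absurd hdz ((hDU hd).2 z hz))
  exact Set.disjoint_left.mpr fun d hd => (hDU hd).1

/-- A vertex outside a separable `K₄` set has at least three neighbors in the set. -/
lemma SeparableK4.exists_third_neighbor (hfree : ¬ IsInducedMinor hatK4 G)
    (h2 : ∀ v, (G.induce {u | u ≠ v}).Connected) {S : Set α} (hS : SeparableK4 G S)
    (hnt : S.Nontrivial) {v : α} (hv : v ∉ S) (a b : α) :
    ∃ w ∈ S, w ≠ a ∧ w ≠ b ∧ G.Adj v w := by
  by_contra! hno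
  have hab : ∀ w ∈ S, G.Adj v w → w = a ∨ w = b := by
    intro w hw hvw
    by_contra! h
    exact hno w hw h.1 h.2 hvw
  obtain ⟨s, hs, hvs⟩ := hS.exists_neighbor hfree h2 hnt hv
  obtain ⟨t, ht, hts, hvt⟩ := hS.not_unique_neighbor hfree h2 hnt hv hs hvs
  refine hfree (hS.isInducedMinor_hatK4 (connected_induce_singleton v) (by simpa using hv) hs ht
    hts.symm hts.symm (Or.inl rfl) (Or.inl rfl) (fun h => hv (h ▸ hs)) (fun h => hv (h ▸ ht))
    ⟨v, rfl, hvs⟩ ⟨v, rfl, hvt⟩ ?_)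
  rintro d rfl z hz hdz
  have := hab s hs hvs
  have := hab t ht hvt
  have := hab z hz hdz
  grind

end ForbiddenMinor

section Wheel

variable {α : Type*} {G : SimpleGraph α} {n : ℕ} {f : ℕ → α} {x u v : α}

/-- `f` runs periodically, with period `n`, around a cycle of `G` with `n` vertices. -/
structure IsCycleEnum (G : SimpleGraph α) (n : ℕ) (f : ℕ → α) : Prop where
  pos : 0 < n
  periodic : ∀ i, f (i + n) = f i
  adj : ∀ i, G.Adj (f i) (f (i + 1))
  inj : ∀ i j, i ≤ j → j < i + n → f i = f j → i = j

/-- The vertex `x` has three distinct neighbors among the values of `f`. -/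
def HasThreeNeighbors (G : SimpleGraph α) (f : ℕ → α) (x : α) : Prop :=
  ∃ i j k, f i ≠ f j ∧ f i ≠ f k ∧ f j ≠ f k ∧ G.Adj x (f i) ∧ G.Adj x (f j) ∧ G.Adj x (f k)

/-- `f` enumerates a cycle that forms a wheel with center `x`. -/
structure IsWheelEnum (G : SimpleGraph α) (n : ℕ) (f : ℕ → α) (x : α) : Prop
    extends IsCycleEnum G n f where
  center : ∀ i, f i ≠ x
  three : HasThreeNeighbors G f x

lemma IsCycleEnum.shift (hf : IsCycleEnum G n f) (r : ℕ) :
    IsCycleEnum G n fun i => f (r + i) where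
  pos := hf.pos
  periodic i := by rw [← Nat.add_assoc, hf.periodic]
  adj i := hf.adj (r + i)
  inj i j hij hj h := by
    have := hf.inj (r + i) (r + j) (by omega) (by omega) h
    omega

lemma IsCycleEnum.exists_window (hf : IsCycleEnum G n f) (r j : ℕ) :
    ∃ i, r ≤ i ∧ i < r + n ∧ f i = f j := by
  have hper : Function.Periodic f n := hf.periodic
  have hle : r ≤ j + r * n := by nlinarith [hf.pos]
  refine ⟨r + (j + r * n - r) % n, by omega, by
    have := Nat.mod_lt (j + r * n - r) hf.pos
    omega, ?_⟩
  have hper' : Function.Periodic (fun i => f (r + i)) n := (hf.shift r).periodic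
  have h := hper'.map_mod_nat (j + r * n - r)
  rw [h, Nat.add_sub_cancel' hle]
  simpa using hper.nat_mul r j

lemma HasThreeNeighbors.shift (hf : IsCycleEnum G n f) (h : HasThreeNeighbors G f x) (r : ℕ) :
    HasThreeNeighbors G (fun i => f (r + i)) x := by
  obtain ⟨i, j, k, hij, hik, hjk, hi, hj, hk⟩ := h
  have hw : ∀ i, ∃ i', f (r + i') = f i := by
    intro i
    obtain ⟨i', hr, -, h⟩ := hf.exists_window r i
    exact ⟨i' - r, by rwa [Nat.add_sub_cancel' hr]⟩
  obtain ⟨i', hi'⟩ := hw i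
  obtain ⟨j', hj'⟩ := hw j
  obtain ⟨k', hk'⟩ := hw k
  refine ⟨i', j', k', ?_⟩
  simp only [hi', hj', hk']
  exact ⟨hij, hik, hjk, hi, hj, hk⟩

lemma IsWheelEnum.shift (hf : IsWheelEnum G n f x) (r : ℕ) :
    IsWheelEnum G n (fun i => f (r + i)) x :=
  ⟨hf.toIsCycleEnum.shift r, fun i => hf.center (r + i), hf.three.shift hf.toIsCycleEnum r⟩

lemma IsWheelEnum.exists_sorted (hf : IsWheelEnum G n f x) :
    ∃ a b c, a < b ∧ b < c ∧ c < n ∧ G.Adj x (f a) ∧ G.Adj x (f b) ∧ G.Adj x (f c) := by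
  obtain ⟨i, j, k, hij, hik, hjk, hi, hj, hk⟩ := hf.three
  obtain ⟨i', -, hi'n, hi'⟩ := hf.exists_window 0 i
  obtain ⟨j', -, hj'n, hj'⟩ := hf.exists_window 0 j
  obtain ⟨k', -, hk'n, hk'⟩ := hf.exists_window 0 k
  rw [← hi'] at hij hik hi
  rw [← hj'] at hij hjk hj
  rw [← hk'] at hik hjk hk
  have h₁ : i' ≠ j' := fun h => hij (h ▸ rfl)
  have h₂ : i' ≠ k' := fun h => hik (h ▸ rfl)
  have h₃ : j' ≠ k' := fun h => hjk (h ▸ rfl)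
  rcases lt_or_gt_of_ne h₁ with h₁ | h₁ <;> rcases lt_or_gt_of_ne h₂ with h₂ | h₂ <;>
    rcases lt_or_gt_of_ne h₃ with h₃ | h₃
  · exact ⟨i', j', k', h₁, h₃, by omega, hi, hj, hk⟩
  · exact ⟨i', k', j', h₂, h₃, by omega, hi, hk, hj⟩
  · omega
  · exact ⟨k', i', j', h₂, h₁, by omega, hk, hi, hj⟩
  · exact ⟨j', i', k', h₁, h₂, by omega, hj, hi, hk⟩
  · omega
  · exact ⟨j', k', i', h₃, h₂, by omega, hj, hk, hi⟩
  · exact ⟨k', j', i', h₃, h₁, by omega, hk, hj, hi⟩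

lemma IsCycleEnum.connected_arc (hf : IsCycleEnum G n f) {i j : ℕ} (hij : i < j) :
    (G.induce (f '' Set.Ico i j)).Connected := by
  induction j, hij using Nat.le_induction with
  | base =>
    have : f '' Set.Ico i (i + 1) = {f i} := by
      rw [← Set.image_singleton]
      congr 1
      ext k
      simp only [Set.mem_Ico, Set.mem_singleton_iff]
      omega
    rw [this]
    exact connected_induce_singleton _
  | succ j hij ih =>
    have : f '' Set.Ico i (j + 1) = f '' Set.Ico i j ∪ {f j} := by
      rw [← Set.image_singleton, ← Set.image_union]
      congr 1
      ext k
      simp only [Set.mem_Ico, Set.mem_union, Set.mem_singleton_iff]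
      omega
    rw [this]
    have hadj := hf.adj (j - 1)
    rw [Nat.sub_add_cancel (by omega)] at hadj
    exact connected_induce_insert ih ⟨j - 1, ⟨by omega, by omega⟩, rfl⟩ hadj

/-- The vertices of the cycle enumerated by `f`, together with `x`. -/
def wheelVerts (f : ℕ → α) (x : α) : Set α := Set.range f ∪ {x}

/-- Three consecutive arcs of the cycle together with the center. -/
def arcModel (n : ℕ) (f : ℕ → α) (x : α) (i j k : ℕ) : Fin 4 → Set α :=
  ![f '' Set.Ico i j, f '' Set.Ico j k, f '' Set.Ico k (i + n), {x}]

lemma IsWheelEnum.isK4Model_arcModel (hf : IsWheelEnum G n f x) {i j k : ℕ} (hij : i < j)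
    (hjk : j < k) (hk : k < i + n) (h₁ : ∃ p, i ≤ p ∧ p < j ∧ G.Adj x (f p))
    (h₂ : ∃ p, j ≤ p ∧ p < k ∧ G.Adj x (f p)) (h₃ : ∃ p, k ≤ p ∧ p < i + n ∧ G.Adj x (f p)) :
    IsK4Model_s10 G (arcModel n f x i j k) := by
  have hdisj : ∀ {a b c d : ℕ}, i ≤ a → b ≤ c → d ≤ i + n →
      Disjoint (f '' Set.Ico a b) (f '' Set.Ico c d) := by
    intro a b c d ha hbc hd
    rw [Set.disjoint_left]
    rintro _ ⟨p, ⟨hp, hp'⟩, rfl⟩ ⟨q, ⟨hq, hq'⟩, hpq⟩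
    have := hf.inj p q (by omega) (by omega) hpq.symm
    omega
  have hx : ∀ {a b : ℕ}, Disjoint (f '' Set.Ico a b) {x} := by
    intro a b
    rw [Set.disjoint_singleton_right]
    rintro ⟨p, -, hp⟩
    exact hf.center p hp
  have hcons : ∀ {a b c : ℕ}, a < b → b < c →
      ∃ y ∈ f '' Set.Ico a b, ∃ z ∈ f '' Set.Ico b c, G.Adj y z := by
    intro a b c hab hbc
    refine ⟨_, ⟨b - 1, ⟨by omega, by omega⟩, rfl⟩, _, ⟨b, ⟨by omega, by omega⟩, rfl⟩, ?_⟩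
    have := hf.adj (b - 1)
    rwa [Nat.sub_add_cancel (by omega)] at this
  have hcent : ∀ {a b : ℕ}, (∃ p, a ≤ p ∧ p < b ∧ G.Adj x (f p)) →
      ∃ y ∈ f '' Set.Ico a b, ∃ z ∈ ({x} : Set α), G.Adj y z := by
    rintro a b ⟨p, hap, hpb, hp⟩
    exact ⟨_, ⟨p, ⟨hap, hpb⟩, rfl⟩, x, rfl, hp.symm⟩
  have hclose : ∃ y ∈ f '' Set.Ico k (i + n), ∃ z ∈ f '' Set.Ico i j, G.Adj y z := by
    refine ⟨_, ⟨i + n - 1, ⟨by omega, by omega⟩, rfl⟩, _, ⟨i, ⟨by omega, by omega⟩, rfl⟩, ?_⟩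
    have := hf.adj (i + n - 1)
    rwa [Nat.sub_add_cancel (by omega), hf.periodic] at this
  have hsymm : ∀ {s t : Set α}, (∃ y ∈ s, ∃ z ∈ t, G.Adj y z) →
      ∃ y ∈ t, ∃ z ∈ s, G.Adj y z := by
    rintro s t ⟨y, hy, z, hz, h⟩
    exact ⟨z, hz, y, hy, h.symm⟩
  refine ⟨fun a => ?_, fun a b hab => ?_, fun a b hab => ?_⟩
  · fin_cases a
    · exact hf.connected_arc hij
    · exact hf.connected_arc hjk
    · exact hf.connected_arc hk
    · exact connected_induce_singleton x
  · have h01 := hdisj (b := j) (c := j) (d := k) le_rfl le_rfl (by omega)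
    have h02 := hdisj (b := j) (c := k) le_rfl (by omega) le_rfl
    have h12 := hdisj (a := j) (b := k) (c := k) (by omega) le_rfl le_rfl
    fin_cases a <;> fin_cases b <;> first
      | exact absurd rfl hab
      | exact h01
      | exact h01.symm
      | exact h02
      | exact h02.symm
      | exact h12
      | exact h12.symm
      | exact hx
      | exact hx.symm
  · fin_cases a <;> fin_cases b <;> first
      | exact absurd rfl hab
      | exact hcons hij hjk
      | exact hsymm (hcons hij hjk)
      | exact hcons hjk hk
      | exact hsymm (hcons hjk hk)
      | exact hclose
      | exact hsymm hclose
      | exact hcent h₁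
      | exact hsymm (hcent h₁)
      | exact hcent h₂
      | exact hsymm (hcent h₂)
      | exact hcent h₃
      | exact hsymm (hcent h₃)

lemma IsCycleEnum.iUnion_arcModel (hf : IsCycleEnum G n f) (x : α) (i j k : ℕ) :
    ⋃ a, arcModel n f x i j k a = wheelVerts f x := by
  ext y
  simp only [Set.mem_iUnion, wheelVerts, Set.mem_union, Set.mem_range, Set.mem_singleton_iff]
  constructor
  · rintro ⟨a, ha⟩
    fin_cases a
    · exact Or.inl ⟨_, ha.choose_spec.2⟩
    · exact Or.inl ⟨_, ha.choose_spec.2⟩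
    · exact Or.inl ⟨_, ha.choose_spec.2⟩
    · exact Or.inr ha
  · rintro (⟨p, rfl⟩ | rfl)
    · obtain ⟨q, hq, hq', h⟩ := hf.exists_window i p
      rw [← h]
      rcases lt_or_ge q j with hqj | hqj
      · exact ⟨0, q, ⟨hq, hqj⟩, rfl⟩
      rcases lt_or_ge q k with hqk | hqk
      · exact ⟨1, q, ⟨hqj, hqk⟩, rfl⟩
      · exact ⟨2, q, ⟨hqk, hq'⟩, rfl⟩
    · exact ⟨3, rfl⟩

lemma IsWheelEnum.separableK4 (hf : IsWheelEnum G n f x) :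
    SeparableK4 G (wheelVerts f x) := by
  have hperm : ∀ {s₁ s₂ : α} {B : Fin 4 → Set α}, IsK4Model_s10 G B →
      (⋃ a, B a) = wheelVerts f x → ∀ p q, p ≠ q → s₁ ∈ B p → s₂ ∈ B q →
      ∃ B : Fin 4 → Set α, IsK4Model_s10 G B ∧ (⋃ a, B a) = wheelVerts f x ∧
        s₁ ∈ B 0 ∧ s₂ ∈ B 1 := by
    intro s₁ s₂ B hB hBu p q hpq hs₁ hs₂
    obtain ⟨σ, rfl, rfl⟩ := exists_perm_fin_four p q hpq
    exact ⟨B ∘ σ, hB.comp σ, by rw [← hBu]; exact σ.surjective.iUnion_comp B, hs₁, hs₂⟩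
  have hcut : ∀ {s₁ s₂ : α} (r : ℕ) {i j k : ℕ}, i < j → j < k → k < i + n →
      (∃ p, i ≤ p ∧ p < j ∧ G.Adj x (f (r + p))) →
      (∃ p, j ≤ p ∧ p < k ∧ G.Adj x (f (r + p))) →
      (∃ p, k ≤ p ∧ p < i + n ∧ G.Adj x (f (r + p))) →
      (∃ p q, p ≠ q ∧ s₁ ∈ arcModel n (fun i => f (r + i)) x i j k p ∧
        s₂ ∈ arcModel n (fun i => f (r + i)) x i j k q) →
      ∃ B : Fin 4 → Set α, IsK4Model_s10 G B ∧ (⋃ a, B a) = wheelVerts f x ∧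
        s₁ ∈ B 0 ∧ s₂ ∈ B 1 := by
    rintro s₁ s₂ r i j k hij hjk hk h₁ h₂ h₃ ⟨p, q, hpq, hs₁, hs₂⟩
    refine hperm ((hf.shift r).isK4Model_arcModel hij hjk hk h₁ h₂ h₃) ?_ p q hpq hs₁ hs₂
    rw [(hf.shift r).iUnion_arcModel x i j k, wheelVerts, wheelVerts]
    congr 1
    ext y
    constructor
    · rintro ⟨p, rfl⟩
      exact ⟨_, rfl⟩
    · rintro ⟨p, rfl⟩
      obtain ⟨q, hq, -, h⟩ := hf.exists_window r p
      exact ⟨q - r, by simp only [Nat.add_sub_cancel' hq, h]⟩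
  have hcenter : ∀ s ∈ Set.range f, ∃ B : Fin 4 → Set α, IsK4Model_s10 G B ∧
      (⋃ a, B a) = wheelVerts f x ∧ ∃ p ≠ 3, s ∈ B p ∧ x ∈ B 3 := by
    rintro s ⟨r, rfl⟩
    obtain ⟨a, b, c, hab, hbc, hcn, ha, hb, hc⟩ := hf.exists_sorted
    have hU := hf.iUnion_arcModel x 0 b c
    refine ⟨_, hf.isK4Model_arcModel (i := 0) (j := b) (k := c) (by omega) hbc (by omega)
      ⟨a, by omega, hab, ha⟩ ⟨b, le_rfl, hbc, hb⟩ ⟨c, le_rfl, by omega, hc⟩, hU, ?_⟩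
    have hr : f r ∈ wheelVerts f x := Or.inl ⟨r, rfl⟩
    rw [← hU] at hr
    obtain ⟨p, hp⟩ := Set.mem_iUnion.mp hr
    refine ⟨p, ?_, hp, rfl⟩
    rintro rfl
    exact hf.center r hp
  intro s₁ hs₁ s₂ hs₂ hne
  rcases hs₁ with hs₁ | rfl
  · rcases hs₂ with ⟨p, rfl⟩ | rfl
    · obtain ⟨r, rfl⟩ := hs₁
      obtain ⟨q', hq', hqn, hq⟩ := hf.exists_window r p
      obtain ⟨q, rfl⟩ := Nat.exists_eq_add_of_le hq'
      rw [← hq] at hne ⊢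
      have hq0 : 0 < q := by
        rcases Nat.eq_zero_or_pos q with rfl | h
        · exact absurd rfl hne
        · exact h
      obtain ⟨a, b, c, hab, hbc, hcn, ha, hb, hc⟩ := (hf.shift r).exists_sorted
      rcases le_or_gt q a with hqa | hqa
      · refine hcut r (i := q) (j := b) (k := c) (by omega) hbc (by omega)
          ⟨a, hqa, hab, ha⟩ ⟨b, le_rfl, hbc, hb⟩ ⟨c, le_rfl, by omega, hc⟩
          ⟨2, 0, by decide, ⟨n, ⟨by omega, by omega⟩, ?_⟩, ⟨q, ⟨le_rfl, by omega⟩, rfl⟩⟩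
        exact hf.periodic r
      rcases le_or_gt q b with hqb | hqb
      · exact hcut r (i := 0) (j := q) (k := c) hq0 (by omega) (by omega)
          ⟨a, by omega, hqa, ha⟩ ⟨b, hqb, hbc, hb⟩ ⟨c, le_rfl, by omega, hc⟩
          ⟨0, 1, by decide, ⟨0, ⟨le_rfl, hq0⟩, rfl⟩, ⟨q, ⟨le_rfl, by omega⟩, rfl⟩⟩
      rcases le_or_gt q c with hqc | hqc
      · exact hcut r (i := 0) (j := b) (k := q) (by omega) hqb (by omega)
          ⟨a, by omega, hab, ha⟩ ⟨b, le_rfl, hqb, hb⟩ ⟨c, hqc, by omega, hc⟩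
          ⟨0, 2, by decide, ⟨0, ⟨le_rfl, by omega⟩, rfl⟩, ⟨q, ⟨le_rfl, by omega⟩, rfl⟩⟩
      · exact hcut r (i := 0) (j := b) (k := c) (by omega) hbc (by omega)
          ⟨a, by omega, hab, ha⟩ ⟨b, le_rfl, hbc, hb⟩ ⟨c, le_rfl, by omega, hc⟩
          ⟨0, 2, by decide, ⟨0, ⟨le_rfl, by omega⟩, rfl⟩, ⟨q, ⟨by omega, by omega⟩, rfl⟩⟩
    · obtain ⟨B, hB, hU, p, hp, hs, hx⟩ := hcenter s₁ hs₁
      exact hperm hB hU p 3 hp hs hx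
  · rcases hs₂ with hs₂ | rfl
    · obtain ⟨B, hB, hU, p, hp, hs, hx⟩ := hcenter s₂ hs₂
      exact hperm hB hU 3 p hp.symm hx hs
    · exact absurd rfl hne

lemma IsWheelEnum.exists_third_neighbor (hf : IsWheelEnum G n f x)
    (hfree : ¬ IsInducedMinor hatK4 G) (h2 : ∀ v, (G.induce {u | u ≠ v}).Connected)
    (hv : ∀ i, f i ≠ v) (hvx : v ≠ x) (a b : α) :
    ∃ w ∈ wheelVerts f x, w ≠ a ∧ w ≠ b ∧ G.Adj v w := by
  refine hf.separableK4.exists_third_neighbor hfree h2 ?_ ?_ a b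
  · exact ⟨f 0, Or.inl ⟨0, rfl⟩, x, Or.inr rfl, hf.center 0⟩
  · rintro (⟨i, hi⟩ | h)
    · exact hv i hi
    · exact hvx h

lemma IsWheelEnum.touches_arc (hf : IsWheelEnum G n f x) (hfree : ¬ IsInducedMinor hatK4 G)
    (hv : ∀ i, f i ≠ v) (hvx : v ≠ x) {i j k : ℕ} (hij : i < j) (hjk : j < k) (hk : k < i + n)
    (h₁ : ∃ p, i ≤ p ∧ p < j ∧ G.Adj x (f p)) (h₂ : ∃ p, j ≤ p ∧ p < k ∧ G.Adj x (f p))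
    (h₃ : ∃ p, k ≤ p ∧ p < i + n ∧ G.Adj x (f p)) {p q : Fin 4} (hpq : p ≠ q) :
    ¬ ∀ a, (∃ y ∈ arcModel n f x i j k a, G.Adj v y) ↔ a = p ∨ a = q := by
  intro h
  refine hfree ((hf.isK4Model_arcModel hij hjk hk h₁ h₂ h₃).isInducedMinor_hatK4_of_ne
    (connected_induce_singleton v) ?_ hpq fun a => ?_)
  · intro a
    rw [Set.disjoint_singleton_left]
    intro hva
    have hmem := Set.mem_iUnion_of_mem (s := arcModel n f x i j k) a hva
    rw [hf.iUnion_arcModel] at hmem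
    rcases hmem with ⟨l, hl⟩ | hmem
    · exact hv l hl
    · exact hvx hmem
  · rw [← h a]
    simp

/-- A vertex not adjacent to the center cannot touch exactly two of three arcs that each
contain a neighbor of the center. -/
lemma IsWheelEnum.false_of_avoids_arc (hf : IsWheelEnum G n f x)
    (hfree : ¬ IsInducedMinor hatK4 G) (hv : ∀ i, f i ≠ v) (hvx : v ≠ x) (hna : ¬ G.Adj v x)
    {i j k : ℕ} (hij : i < j) (hjk : j < k) (hk : k < i + n)
    (h₁ : ∃ p, i ≤ p ∧ p < j ∧ G.Adj x (f p)) (h₂ : ∃ p, j ≤ p ∧ p < k ∧ G.Adj x (f p))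
    (h₃ : ∃ p, k ≤ p ∧ p < i + n ∧ G.Adj x (f p)) (h₁' : ∀ p, i ≤ p → p < j → ¬ G.Adj v (f p))
    (h₂' : ∃ p, j ≤ p ∧ p < k ∧ G.Adj v (f p))
    (h₃' : ∃ p, k ≤ p ∧ p < i + n ∧ G.Adj v (f p)) : False := by
  refine hf.touches_arc hfree hv hvx hij hjk hk h₁ h₂ h₃ (p := 1) (q := 2) (by decide) fun a => ?_
  fin_cases a
  · refine iff_of_false ?_ (by decide)
    rintro ⟨_, ⟨p, ⟨hp, hp'⟩, rfl⟩, h⟩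
    exact h₁' p hp hp' h
  · obtain ⟨p, hp, hp', h⟩ := h₂'
    exact iff_of_true ⟨_, ⟨p, ⟨hp, hp'⟩, rfl⟩, h⟩ (by decide)
  · obtain ⟨p, hp, hp', h⟩ := h₃'
    exact iff_of_true ⟨_, ⟨p, ⟨hp, hp'⟩, rfl⟩, h⟩ (by decide)
  · refine iff_of_false ?_ (by decide)
    rintro ⟨_, rfl, h⟩
    exact hna h

/-- A vertex adjacent to the center touches at least two of three arcs that each contain a
neighbor of the center, provided it touches the cycle. -/
lemma IsWheelEnum.false_of_single_arc (hf : IsWheelEnum G n f x)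
    (hfree : ¬ IsInducedMinor hatK4 G) (hv : ∀ i, f i ≠ v) (hvx : G.Adj v x)
    {i j k : ℕ} (hij : i < j) (hjk : j < k) (hk : k < i + n)
    (h₁ : ∃ p, i ≤ p ∧ p < j ∧ G.Adj x (f p)) (h₂ : ∃ p, j ≤ p ∧ p < k ∧ G.Adj x (f p))
    (h₃ : ∃ p, k ≤ p ∧ p < i + n ∧ G.Adj x (f p))
    (h₁' : ∃ p, i ≤ p ∧ p < j ∧ G.Adj v (f p))
    (h' : ∀ p, j ≤ p → p < i + n → ¬ G.Adj v (f p)) : False := by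
  refine hf.touches_arc hfree hv hvx.ne hij hjk hk h₁ h₂ h₃ (p := 0) (q := 3) (by decide)
    fun a => ?_
  fin_cases a
  · obtain ⟨p, hp, hp', h⟩ := h₁'
    exact iff_of_true ⟨_, ⟨p, ⟨hp, hp'⟩, rfl⟩, h⟩ (by decide)
  · refine iff_of_false ?_ (by decide)
    rintro ⟨_, ⟨p, ⟨hp, hp'⟩, rfl⟩, h⟩
    exact h' p hp (by omega) h
  · refine iff_of_false ?_ (by decide)
    rintro ⟨_, ⟨p, ⟨hp, hp'⟩, rfl⟩, h⟩
    exact h' p (by omega) hp' h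
  · exact iff_of_true ⟨_, rfl, hvx⟩ (by decide)

/-- The neighbors on the cycle of a vertex not adjacent to the center cannot be confined to a
segment `f 0, …, f m` whose complement contains a neighbor of the center. -/
lemma IsWheelEnum.false_of_gap (hf : IsWheelEnum G n f x)
    (hfree : ¬ IsInducedMinor hatK4 G) (hv : ∀ i, f i ≠ v) (hvx : v ≠ x) (hna : ¬ G.Adj v x)
    {m g : ℕ} (hm : 0 < m) (h0 : G.Adj v (f 0)) (hvm : G.Adj v (f m))
    (hgap : ∀ i, m < i → i < n → ¬ G.Adj v (f i)) (hmg : m < g) (hgn : g < n)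
    (hg : G.Adj x (f g)) : False := by
  obtain ⟨a, b, c, hab, hbc, hcn, ha, hb, hc⟩ := hf.exists_sorted
  have hper : ∀ {y : α} {i}, G.Adj y (f i) → G.Adj y (f (n + i)) := by
    intro y i h
    rwa [Nat.add_comm, hf.periodic]
  have hn0 : G.Adj v (f n) := hper h0
  rcases le_or_gt b m with hbm | hbm
  · exact hf.false_of_avoids_arc hfree hv hvx hna (i := m + 1) (j := n) (k := n + b)
      (by omega) (by omega) (by omega) ⟨g, by omega, hgn, hg⟩
      ⟨n + a, by omega, by omega, hper ha⟩ ⟨n + b, by omega, by omega, hper hb⟩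
      (fun p hp hp' => hgap p (by omega) hp') ⟨n, by omega, by omega, hn0⟩
      ⟨n + m, by omega, by omega, hper hvm⟩
  rcases le_or_gt a m with ham | ham
  · rcases Nat.eq_zero_or_pos a with rfl | ha0
    · exact hf.false_of_avoids_arc hfree hv hvx hna (i := c) (j := n) (k := n + m)
        (by omega) (by omega) (by omega) ⟨c, le_rfl, hcn, hc⟩
        ⟨n + 0, by omega, by omega, hper ha⟩ ⟨n + b, by omega, by omega, hper hb⟩
        (fun p hp hp' => hgap p (by omega) hp') ⟨n, by omega, by omega, hn0⟩
        ⟨n + m, by omega, by omega, hper hvm⟩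
    · exact hf.false_of_avoids_arc hfree hv hvx hna (i := m + 1) (j := c) (k := n + 1)
        (by omega) (by omega) (by omega) ⟨b, by omega, hbc, hb⟩
        ⟨c, le_rfl, by omega, hc⟩ ⟨n + a, by omega, by omega, hper ha⟩
        (fun p hp hp' => hgap p (by omega) (by omega)) ⟨n, by omega, by omega, hn0⟩
        ⟨n + m, by omega, by omega, hper hvm⟩
  · exact hf.false_of_avoids_arc hfree hv hvx hna (i := b) (j := c) (k := n + 1)
      (by omega) (by omega) (by omega) ⟨b, le_rfl, hbc, hb⟩
      ⟨c, le_rfl, by omega, hc⟩ ⟨n + a, by omega, by omega, hper ha⟩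
      (fun p hp hp' => hgap p (by omega) (by omega)) ⟨n, by omega, by omega, hn0⟩
      ⟨n + m, by omega, by omega, hper hvm⟩

lemma IsWheelEnum.adj_of_center_adj (hf : IsWheelEnum G n f x)
    (hfree : ¬ IsInducedMinor hatK4 G) (hv : ∀ i, f i ≠ v) (hvx : v ≠ x) (hna : ¬ G.Adj v x)
    (htwo : ∃ i j, f i ≠ f j ∧ G.Adj v (f i) ∧ G.Adj v (f j)) {r : ℕ} (hr : G.Adj x (f r)) :
    G.Adj v (f r) := by
  classical
  by_contra hvr
  have hg := hf.shift r
  obtain ⟨p, q, hpq, hqn, hp, hq⟩ : ∃ p q, p < q ∧ q < n ∧ G.Adj v (f (r + p)) ∧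
      G.Adj v (f (r + q)) := by
    obtain ⟨i, j, hij, hi, hj⟩ := htwo
    obtain ⟨i', hri, hin, hi'⟩ := hf.exists_window r i
    obtain ⟨j', hrj, hjn, hj'⟩ := hf.exists_window r j
    rw [← hi'] at hij hi
    rw [← hj'] at hij hj
    obtain ⟨p, rfl⟩ := Nat.exists_eq_add_of_le hri
    obtain ⟨q, rfl⟩ := Nat.exists_eq_add_of_le hrj
    rcases lt_trichotomy p q with h | rfl | h
    · exact ⟨p, q, h, by omega, hi, hj⟩
    · exact absurd rfl hij
    · exact ⟨q, p, h, by omega, hj, hi⟩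
  have hex : ∃ i, G.Adj v (f (r + i)) := ⟨p, hp⟩
  let first := Nat.find hex
  let last := Nat.findGreatest (fun i => G.Adj v (f (r + i))) (n - 1)
  have hfirst : G.Adj v (f (r + first)) := Nat.find_spec hex
  have hfirst_min : ∀ i, i < first → ¬ G.Adj v (f (r + i)) := fun i hi => Nat.find_min hex hi
  have hlast : G.Adj v (f (r + last)) :=
    Nat.findGreatest_spec (P := fun i => G.Adj v (f (r + i))) (m := q) (by omega) hq
  have hlast_max : ∀ i, last < i → i ≤ n - 1 → ¬ G.Adj v (f (r + i)) := fun i hi hin =>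
    Nat.findGreatest_is_greatest hi hin
  have hlast_le : last ≤ n - 1 := Nat.findGreatest_le _
  have hqlast : q ≤ last := Nat.le_findGreatest (by omega) hq
  have hfirstp : first ≤ p := Nat.find_min' hex hp
  have hfirst_pos : 0 < first := by
    rcases Nat.eq_zero_or_pos first with h | h
    · rw [h] at hfirst
      exact absurd hfirst hvr
    · exact h
  refine (hg.shift first).false_of_gap hfree (fun i => hv _) hvx hna (m := last - first)
    (g := n - first) (by omega) hfirst ?_ ?_ (by omega) (by omega) ?_
  · rwa [Nat.add_sub_cancel' (by omega)]
  · intro i hi hin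
    rcases lt_or_ge (first + i) n with h | h
    · exact hlast_max (first + i) (by omega) (by omega)
    · have hi' : r + (first + i) = r + (first + i - n) + n := by omega
      simp only [hi', hf.periodic]
      exact hfirst_min _ (by omega)
  · rwa [Nat.add_sub_cancel' (by omega), hf.periodic]

/-- A vertex not adjacent to the center of a wheel has the same neighbors on the cycle as the
center. -/
lemma IsWheelEnum.adj_iff_center_adj (hf : IsWheelEnum G n f x)
    (hfree : ¬ IsInducedMinor hatK4 G) (h2 : ∀ v, (G.induce {u | u ≠ v}).Connected)
    (hv : ∀ i, f i ≠ v) (hvx : v ≠ x) (hna : ¬ G.Adj v x) (r : ℕ) :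
    G.Adj v (f r) ↔ G.Adj x (f r) := by
  have hnb : ∀ a, ∃ i, f i ≠ a ∧ G.Adj v (f i) := by
    intro a
    obtain ⟨w, hw, hwa, -, hvw⟩ := hf.exists_third_neighbor hfree h2 hv hvx a a
    rcases hw with ⟨i, rfl⟩ | rfl
    · exact ⟨i, hwa, hvw⟩
    · exact absurd hvw hna
  have hsub : ∀ i, G.Adj x (f i) → G.Adj v (f i) := by
    obtain ⟨i, -, hi⟩ := hnb v
    obtain ⟨j, hij, hj⟩ := hnb (f i)
    exact fun l hl => hf.adj_of_center_adj hfree hv hvx hna ⟨j, i, hij, hj, hi⟩ hl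
  obtain ⟨i, j, k, hij, hik, hjk, hi, hj, hk⟩ := hf.three
  have hfv : IsWheelEnum G n f v :=
    ⟨hf.toIsCycleEnum, hv, i, j, k, hij, hik, hjk, hsub i hi, hsub j hj, hsub k hk⟩
  exact ⟨hfv.adj_of_center_adj hfree hf.center hvx.symm (fun h => hna h.symm)
    ⟨i, j, hij, hi, hj⟩, hsub r⟩

lemma isCycleEnum_mod {g : ℕ → α} {l : ℕ} (hl : 0 < l)
    (hinj : ∀ i j, i < l → j < l → g i = g j → i = j)
    (hadj : ∀ i, i + 1 < l → G.Adj (g i) (g (i + 1))) (hclose : G.Adj (g (l - 1)) (g 0)) :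
    IsCycleEnum G l fun i => g (i % l) where
  pos := hl
  periodic i := by simp
  adj i := by
    have hi := Nat.mod_lt i hl
    rw [← Nat.mod_add_mod i l 1]
    by_cases h : i % l + 1 = l
    · rw [h, Nat.mod_self, show i % l = l - 1 by omega]
      exact hclose
    · rw [Nat.mod_eq_of_lt (show i % l + 1 < l by omega)]
      exact hadj _ (by omega)
  inj i j hij hj h := by
    have := hinj _ _ (Nat.mod_lt i hl) (Nat.mod_lt j hl) h
    have hd : l ∣ j - i := (Nat.modEq_iff_dvd' hij).mp this
    have := Nat.eq_zero_of_dvd_of_lt hd (by omega)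
    omega

/-- A vertex adjacent to the center whose neighbors on the cycle lie in the segment
`f 0, …, f q` forces two neighbors of the center in that segment. -/
lemma IsWheelEnum.exists_two_in_segment (hf : IsWheelEnum G n f x)
    (hfree : ¬ IsInducedMinor hatK4 G) (hu : ∀ i, f i ≠ u) (hux : G.Adj u x) {q : ℕ}
    (hu0 : G.Adj u (f 0)) (hseg : ∀ i, i < n → G.Adj u (f i) → i ≤ q) :
    ∃ a b, a < b ∧ b ≤ q ∧ G.Adj x (f a) ∧ G.Adj x (f b) := by
  obtain ⟨a, b, c, hab, hbc, hcn, ha, hb, hc⟩ := hf.exists_sorted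
  refine ⟨a, b, hab, ?_, ha, hb⟩
  by_contra hbq
  refine hf.false_of_single_arc hfree hu hux (i := 0) (j := b) (k := c) (by omega) hbc (by omega)
    ⟨a, by omega, hab, ha⟩ ⟨b, le_rfl, hbc, hb⟩ ⟨c, le_rfl, by omega, hc⟩
    ⟨0, le_rfl, by omega, hu0⟩ fun p hp hpn h => ?_
  have := hseg p (by omega) h
  omega

/-- Rerouting a segment of the cycle through `u` gives a wheel with the same center. -/
lemma IsWheelEnum.reroute (hf : IsWheelEnum G n f x) (hu : ∀ i, f i ≠ u) (hux : G.Adj u x)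
    {q a b : ℕ} (hqn : q < n) (hu0 : G.Adj u (f 0)) (huq : G.Adj u (f q)) (hab : a < b)
    (hbq : b ≤ q) (ha : G.Adj x (f a)) (hb : G.Adj x (f b)) :
    ∃ g : ℕ → α, IsWheelEnum G (q + 2) g x ∧ ∀ i, g i = u ∨ ∃ p ≤ q, g i = f p := by
  let h : ℕ → α := fun i => if i = 0 then u else f (i - 1)
  have h0 : h 0 = u := rfl
  have hsucc : ∀ i, h (i + 1) = f i := fun i => rfl
  have hcyc : IsCycleEnum G (q + 2) fun i => h (i % (q + 2)) := by
    refine isCycleEnum_mod (by omega) ?_ ?_ ?_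
    · rintro (_ | i) (_ | j) hi hj hij
      · rfl
      · exact absurd hij.symm (hu j)
      · exact absurd hij (hu i)
      · rw [hsucc, hsucc] at hij
        rcases le_total i j with hle | hle
        · rw [hf.inj i j hle (by omega) hij]
        · rw [hf.inj j i hle (by omega) hij.symm]
    · rintro (_ | i) hi
      · exact hu0
      · exact hf.adj i
    · exact huq.symm
  have hmod : ∀ i, i ≤ q → (i + 1) % (q + 2) = i + 1 := fun i hi => Nat.mod_eq_of_lt (by omega)
  refine ⟨_, ⟨hcyc, ?_, 0, a + 1, b + 1, ?_⟩, ?_⟩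
  · intro i
    rcases Nat.eq_zero_or_pos (i % (q + 2)) with hi | hi
    · simp only [hi, h0]
      exact hux.ne
    · simp only [h, hi.ne', if_false]
      exact hf.center _
  · simp only [hmod a (by omega), hmod b hbq, Nat.zero_mod, h0, hsucc]
    refine ⟨(hu a).symm, (hu b).symm, fun h => ?_, hux.symm, ha, hb⟩
    exact hab.ne (hf.inj a b hab.le (by omega) h)
  · intro i
    have hi := Nat.mod_lt i (show 0 < q + 2 by omega)
    rcases Nat.eq_zero_or_pos (i % (q + 2)) with h' | h'
    · left
      simp only [h', h0]
    · right
      refine ⟨i % (q + 2) - 1, by omega, ?_⟩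
      simp only [h, h'.ne', if_false]

lemma IsWheelEnum.exists_neighbor_in_segment (hf : IsWheelEnum G n f x)
    (hfree : ¬ IsInducedMinor hatK4 G) (h2 : ∀ v, (G.induce {u | u ≠ v}).Connected)
    (hu : ∀ i, f i ≠ u) (hv : ∀ i, f i ≠ v) (hux : G.Adj u x) (hvx : v ≠ x) (huv : u ≠ v)
    (hna : ¬ G.Adj u v) {q : ℕ} (hqn : q < n) (hu0 : G.Adj u (f 0)) (huq : G.Adj u (f q))
    (hseg : ∀ i, i < n → G.Adj u (f i) → i ≤ q) (d : α) :
    ∃ p ≤ q, f p ≠ d ∧ G.Adj v (f p) := by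
  obtain ⟨a, b, hab, hbq, ha, hb⟩ := hf.exists_two_in_segment hfree hu hux hu0 hseg
  obtain ⟨g, hg, hgu⟩ := hf.reroute hu hux hqn hu0 huq hab hbq ha hb
  have hgv : ∀ i, g i ≠ v := by
    intro i
    rcases hgu i with h | ⟨p, -, h⟩
    · rwa [h]
    · rw [h]
      exact hv p
  obtain ⟨w, hw, hwx, hwd, hvw⟩ := hg.exists_third_neighbor hfree h2 hgv hvx x d
  rcases hw with ⟨i, rfl⟩ | hw
  · rcases hgu i with h | ⟨p, hp, h⟩
    · rw [h] at hvw
      exact absurd hvw.symm hna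
    · rw [h] at hwd hvw
      exact ⟨p, hp, hwd, hvw⟩
  · exact absurd hw hwx

/-- Two non-adjacent neighbors of the center, each with at most two neighbors on the cycle:
a cycle neighbor `f 0` of the first is a neighbor of the second. -/
lemma IsWheelEnum.adj_zero_of_adj_zero (hf : IsWheelEnum G n f x)
    (hfree : ¬ IsInducedMinor hatK4 G) (h2 : ∀ v, (G.induce {u | u ≠ v}).Connected)
    (hu : ∀ i, f i ≠ u) (hv : ∀ i, f i ≠ v) (hux : G.Adj u x) (hvx : v ≠ x) (huv : u ≠ v)
    (hna : ¬ G.Adj u v) (hu3 : ¬ HasThreeNeighbors G f u) (hv3 : ¬ HasThreeNeighbors G f v)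
    (hu0 : G.Adj u (f 0)) : G.Adj v (f 0) := by
  have hn := hf.pos
  obtain ⟨q, hqn, huq, hseg⟩ : ∃ q, q < n ∧ G.Adj u (f q) ∧
      ∀ i, i < n → G.Adj u (f i) → i = 0 ∨ i = q := by
    by_cases h : ∃ q, 0 < q ∧ q < n ∧ G.Adj u (f q)
    · obtain ⟨q, hq, hqn, huq⟩ := h
      refine ⟨q, hqn, huq, fun i hin hi => ?_⟩
      by_contra! hne
      refine hu3 ⟨0, q, i, fun h => ?_, fun h => ?_, fun h => ?_, hu0, huq, hi⟩
      · exact hq.ne (hf.inj 0 q (by omega) (by omega) h)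
      · exact hne.1 (hf.inj 0 i (by omega) (by omega) h).symm
      · rcases le_total q i with hle | hle
        · exact hne.2 (hf.inj q i hle (by omega) h).symm
        · exact hne.2 (hf.inj i q hle (by omega) h.symm)
    · push Not at h
      exact ⟨0, hn, hu0, fun i hin hi => Or.inl (by
        by_contra hi0
        exact h i (by omega) hin hi)⟩
  have hseg' : ∀ i, i < n → G.Adj u (f i) → i ≤ q := fun i hin hi => by
    have := hseg i hin hi
    omega
  have hq : 0 < q := by
    obtain ⟨a, b, hab, hbq, -⟩ := hf.exists_two_in_segment hfree hu hux hu0 hseg'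
    omega
  have hside := hf.exists_neighbor_in_segment hfree h2 hu hv hux hvx huv hna hqn hu0 huq hseg'
  have hper0 : f (q + (n - q)) = f 0 := by
    rw [Nat.add_sub_cancel' hqn.le]
    simpa using hf.periodic 0
  have hside' := (hf.shift q).exists_neighbor_in_segment hfree h2 (fun i => hu _) (fun i => hv _)
    hux hvx huv hna (q := n - q) (by omega) huq (by rwa [hper0]) (fun i hin hi => by
      rcases lt_or_ge (q + i) n with h | h
      · omega
      · have hi' : q + i = q + i - n + n := by omega
        rw [hi', hf.periodic] at hi
        have := hseg _ (by omega) hi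
        omega)
  by_contra hv0
  obtain ⟨a, haq, hane, ha⟩ := hside (f q)
  obtain ⟨b, hbq, hbne, hb⟩ := hside (f a)
  obtain ⟨c, hcq, hcne, hc⟩ := hside' (f q)
  have hc0 : c ≠ 0 := by
    rintro rfl
    exact hcne rfl
  have hcn : c ≠ n - q := by
    rintro rfl
    rw [hper0] at hc
    exact hv0 hc
  refine hv3 ⟨a, b, q + c, hbne.symm, fun h => ?_, fun h => ?_, ha, hb, hc⟩
  · have := hf.inj a (q + c) (by omega) (by omega) h
    omega
  · have := hf.inj b (q + c) (by omega) (by omega) h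
    omega

/-- Non-adjacent vertices outside the cycle of a wheel have the same neighbors on the cycle. -/
lemma IsWheelEnum.adj_iff_adj (hf : IsWheelEnum G n f x)
    (hfree : ¬ IsInducedMinor hatK4 G) (h2 : ∀ v, (G.induce {u | u ≠ v}).Connected)
    (hu : ∀ i, f i ≠ u) (hv : ∀ i, f i ≠ v) (huv : u ≠ v) (hna : ¬ G.Adj u v) (r : ℕ) :
    G.Adj u (f r) ↔ G.Adj v (f r) := by
  have hna' : ¬ G.Adj v u := fun h => hna h.symm
  by_cases hu3 : HasThreeNeighbors G f u
  · exact (IsWheelEnum.adj_iff_center_adj ⟨hf.toIsCycleEnum, hu, hu3⟩ hfree h2 hv huv.symm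
      hna' r).symm
  by_cases hv3 : HasThreeNeighbors G f v
  · exact IsWheelEnum.adj_iff_center_adj ⟨hf.toIsCycleEnum, hv, hv3⟩ hfree h2 hu huv hna r
  have hcenter : ∀ w, (∀ i, f i ≠ w) → ¬ HasThreeNeighbors G f w → G.Adj w x := by
    intro w hw hw3
    by_contra hwx
    have hne : w ≠ x := by
      rintro rfl
      exact hw3 hf.three
    obtain ⟨i, j, k, hij, hik, hjk, hi, hj, hk⟩ := hf.three
    have hiff := hf.adj_iff_center_adj hfree h2 hw hne hwx
    exact hw3 ⟨i, j, k, hij, hik, hjk, (hiff i).mpr hi, (hiff j).mpr hj, (hiff k).mpr hk⟩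
  have hux := hcenter u hu hu3
  have hvx := hcenter v hv hv3
  have hthree : ∀ w, ¬ HasThreeNeighbors G f w →
      ¬ HasThreeNeighbors G (fun i => f (r + i)) w := by
    rintro w hw ⟨i, j, k, h⟩
    exact hw ⟨r + i, r + j, r + k, h⟩
  constructor
  · exact (hf.shift r).adj_zero_of_adj_zero hfree h2 (fun i => hu _) (fun i => hv _) hux hvx.ne
      huv hna (hthree u hu3) (hthree v hv3)
  · exact (hf.shift r).adj_zero_of_adj_zero hfree h2 (fun i => hv _) (fun i => hu _) hvx hux.ne
      huv.symm hna' (hthree v hv3) (hthree u hu3)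

/-- Every three-wheel subgraph has a wheel enumeration of its cycle. -/
lemma ThreeWheelSub.exists_isWheelEnum (W : ThreeWheelSub G) :
    ∃ (n : ℕ) (f : ℕ → α), IsWheelEnum G n f W.center ∧ Set.range f = {c | c ∈ W.cyc.support} := by
  classical
  have hlen := W.cyc_isCycle.three_le_length
  have hcyc : IsCycleEnum G W.cyc.length fun i => W.cyc.getVert (i % W.cyc.length) := by
    refine isCycleEnum_mod (by omega) ?_ ?_ ?_
    · intro i j hi hj hij
      exact W.cyc_isCycle.getVert_injOn' (show i ≤ _ by omega) (show j ≤ _ by omega) hij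
    · exact fun i hi => W.cyc.adj_getVert_succ (by omega)
    · have := W.cyc.adj_getVert_succ (i := W.cyc.length - 1) (by omega)
      rw [Nat.sub_add_cancel (by omega), Walk.getVert_length] at this
      rwa [Walk.getVert_zero]
  have hrange : Set.range (fun i => W.cyc.getVert (i % W.cyc.length)) =
      {c | c ∈ W.cyc.support} := by
    ext c
    constructor
    · rintro ⟨i, rfl⟩
      exact Walk.getVert_mem_support _ _
    · intro hc
      obtain ⟨i, rfl, hi⟩ := Walk.mem_support_iff_exists_getVert.mp hc
      rcases hi.lt_or_eq with hi | rfl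
      · exact ⟨i, by simp only [Nat.mod_eq_of_lt hi]⟩
      · exact ⟨0, by simp⟩
  refine ⟨_, _, ⟨hcyc, fun i hi => W.center_not_mem ?_, ?_⟩, hrange⟩
  · rw [← hi]
    exact Walk.getVert_mem_support _ _
  · obtain ⟨a, b, c, hab, hac, hbc, hs⟩ := Finset.card_eq_three.mp W.spokes_card
    have hmem : ∀ y ∈ W.spokes, ∃ i, W.cyc.getVert (i % W.cyc.length) = y := fun y hy =>
      hrange.symm.subset (W.spokes_sub y hy)
    obtain ⟨i, hi⟩ := hmem a (by simp [hs])
    obtain ⟨j, hj⟩ := hmem b (by simp [hs])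
    obtain ⟨k, hk⟩ := hmem c (by simp [hs])
    refine ⟨i, j, k, ?_⟩
    simp only [hi, hj, hk]
    exact ⟨hab, hac, hbc, W.spokes_adj a (by simp [hs]), W.spokes_adj b (by simp [hs]),
      W.spokes_adj c (by simp [hs])⟩

end Wheel

/-- Any two non-adjacent vertices outside the cycle of a minimum 3-wheel have the same
neighborhood on the cycle. -/
theorem nonadjacent_same_neighborhood {α : Type*} [Fintype α] [DecidableEq α]
    (G : SimpleGraph α)
    (h2 : TwoConnected G) (hfree : ¬ IsInducedMinor hatK4 G)
    (hprop : HasProperK4Subdivision G)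
    (W : ThreeWheelSub G) (hmin : ∀ W' : ThreeWheelSub G, W.order ≤ W'.order)
    (u v : α) (hu : u ∉ W.cyc.support) (hv : v ∉ W.cyc.support)
    (huv : u ≠ v) (hnadj : ¬ G.Adj u v) :
    ∀ c ∈ W.cyc.support, (G.Adj u c ↔ G.Adj v c) := by
  obtain ⟨n, f, hf, hrange⟩ := W.exists_isWheelEnum
  have hout : ∀ {w}, w ∉ W.cyc.support → ∀ i, f i ≠ w := by
    rintro w hw i rfl
    exact hw (hrange.subset ⟨i, rfl⟩)
  intro c hc
  obtain ⟨r, rfl⟩ := hrange.symm.subset hc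
  exact hf.adj_iff_adj hfree h2.2 (hout hu) (hout hv) huv hnadj r

end IMWQO
end
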